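/- arXiv:2311.02784 — 3 statements merged into one kernel-verified Lean document; each statement's English description precedes it below -/
import Mathlib

section
/- Let H be a finitely generated subgroup of F_n and A a free factor of F_n containing H. Then H is echelon in F_n if and only if H is echelon in A. -/
/-- `s` is a free basis of the group `G`: the induced map from the free group is bijective. -/
def IsFreeBasis {G : Type} [Group G] {ι : Type} (s : ι → G) : Prop :=
  Function.Bijective (FreeGroup.lift s)

/-- `s` is a free basis of the subgroup `H` of `G`. -/
def IsBasisOf {G : Type} [Group G] {ι : Type} (s : ι → G) (H : Subgroup G) : Prop :=
  Function.Injective (FreeGroup.lift s) ∧ Subgroup.closure (Set.range s) = H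

/-- `A` is a free factor of `G`: `G` is the internal free product of `A` with some subgroup `B`. -/
def IsFreeFactor {G : Type} [Group G] (A : Subgroup G) : Prop :=
  ∃ B : Subgroup G, Function.Bijective (Monoid.Coprod.lift A.subtype B.subtype)

/-- `A` is a free factor of the subgroup `H` of `G`. -/
def IsFreeFactorIn {G : Type} [Group G] (A H : Subgroup G) : Prop :=
  A ≤ H ∧ IsFreeFactor (A.subgroupOf H)

/-- The subgroup `H` is a free group of rank `r`. -/
def HasRank {G : Type} [Group G] (H : Subgroup G) (r : ℕ) : Prop :=
  Nonempty (FreeGroup (Fin r) ≃* H)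

/-- The subgroup generated by the first `i` elements of the family `b`. -/
def prefixSubgroup {G : Type} [Group G] {n : ℕ} (b : Fin n → G) (i : ℕ) : Subgroup G :=
  Subgroup.closure (b '' {j | (j : ℕ) < i})

/-- `b` is an echelon basis for the subgroup `H`: it is a basis of the ambient group and
the ranks of the intersections with the prefix subgroups grow by at most one at each step. -/
def IsEchelonBasis {G : Type} [Group G] {n : ℕ} (b : Fin n → G) (H : Subgroup G) : Prop :=
  IsFreeBasis b ∧ ∀ i : Fin n, ∃ r r' : ℕ,
    HasRank (H ⊓ prefixSubgroup b (i : ℕ)) r' ∧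
    HasRank (H ⊓ prefixSubgroup b ((i : ℕ) + 1)) r ∧ r ≤ r' + 1

/-- `H` is an echelon subgroup: the ambient group admits an ordered basis which is an
echelon basis for `H`. -/
def IsEchelon {G : Type} [Group G] (H : Subgroup G) : Prop :=
  ∃ (m : ℕ) (b : Fin m → G), IsEchelonBasis b H

/-- `B` is the free factor support of `H`: the minimal (by inclusion) free factor containing `H`. -/
def IsFFSupport {G : Type} [Group G] (H B : Subgroup G) : Prop :=
  IsFreeFactor B ∧ H ≤ B ∧ ∀ B' : Subgroup G, IsFreeFactor B' → H ≤ B' → B ≤ B'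


namespace Ech
open Subgroup

variable {G : Type} [Group G]

/-- The group element of a signed letter. -/
def letter {X : Type} (b : X → G) (l : X × Bool) : G := cond l.2 (b l.1) (b l.1)⁻¹

/-- The orbit of the base coset under the subgroup generated by the letters in `S`. -/
def orb {X : Type} (b : X → G) (S : Set X) (H : Subgroup G) : Set (G ⧸ H) :=
  {q | ∃ a ∈ closure (b '' S), q = a • ((1 : G) : G ⧸ H)}

lemma exists_word {X : Type} (b : X → G) (S : Set X) (g : G) (hg : g ∈ closure (b '' S)) :
    ∃ w : List (X × Bool), (∀ l ∈ w, l.1 ∈ S) ∧ (w.map (letter b)).prod = g := by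
  induction hg using Subgroup.closure_induction with
  | mem x hx =>
    obtain ⟨i, hi, rfl⟩ := hx
    exact ⟨[(i, true)], by simpa using hi, by simp [letter]⟩
  | one => exact ⟨[], by simp, by simp⟩
  | mul x y _ _ hx hy =>
    obtain ⟨w, hw, rfl⟩ := hx
    obtain ⟨v, hv, rfl⟩ := hy
    refine ⟨w ++ v, ?_, by simp⟩
    intro l hl
    rcases List.mem_append.1 hl with h | h
    · exact hw l h
    · exact hv l h
  | inv x _ hx =>
    obtain ⟨w, hw, rfl⟩ := hx
    refine ⟨(w.map (fun l => (l.1, !l.2))).reverse, ?_, ?_⟩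
    · intro l hl
      simp only [List.mem_reverse, List.mem_map] at hl
      obtain ⟨a, ha, rfl⟩ := hl
      exact hw a ha
    · rw [List.prod_inv_reverse, List.map_reverse, List.map_map, List.map_map]
      congr 2
      apply List.map_congr_left
      rintro ⟨x, _ | _⟩ _ <;> simp [letter]

lemma word_mem {X : Type} (b : X → G) (S : Set X) (w : List (X × Bool))
    (hw : ∀ l ∈ w, l.1 ∈ S) : (w.map (letter b)).prod ∈ closure (b '' S) := by
  apply Subgroup.list_prod_mem
  intro x hx
  obtain ⟨l, hl, rfl⟩ := List.mem_map.1 hx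
  have : b l.1 ∈ closure (b '' S) := subset_closure ⟨_, hw l hl, rfl⟩
  rcases l with ⟨x, _ | _⟩
  · simpa [letter] using this
  · simpa [letter] using this

open Classical in
/-- The cost of a word. -/
noncomputable def cost {X : Type} (S : Set X) (w : List (X × Bool)) : ℕ ×ₗ ℕ :=
  toLex (w.countP (fun l => decide (l.1 ∉ S)), w.length)

lemma exists_parent {X : Type} (b : X → G) (hb : closure (Set.range b) = ⊤) (S : Set X)
    (H : Subgroup G) :
    ∃ ρ : G ⧸ H → ℕ ×ₗ ℕ, ∀ q : G ⧸ H, q ≠ ((1 : G) : G ⧸ H) →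
      ∃ (q' : G ⧸ H) (l : X × Bool), ρ q' < ρ q ∧ q = letter b l • q' ∧
        (q ∈ orb b S H → l.1 ∈ S ∧ q' ∈ orb b S H) := by
  classical
  let W : G ⧸ H → Set (List (X × Bool)) :=
    fun q => {w | (w.map (letter b)).prod • ((1 : G) : G ⧸ H) = q}
  have hne : ∀ q, ∃ w, w ∈ W q ∧ ∀ v ∈ W q, cost S w ≤ cost S v := by
    intro q
    have h1 : (W q).Nonempty := by
      obtain ⟨g, rfl⟩ := QuotientGroup.mk_surjective q
      obtain ⟨w, -, hw⟩ := exists_word b Set.univ g (by simp [hb])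
      exact ⟨w, by simp [W, hw]⟩
    have wf : WellFounded (fun v w : List (X × Bool) => cost S v < cost S w) :=
      InvImage.wf (cost S) wellFounded_lt
    refine ⟨wf.min _ h1, wf.min_mem _ h1, fun v hv => ?_⟩
    exact not_lt.1 (wf.not_lt_min _ hv)
  choose w hw hmin using hne
  refine ⟨fun q => cost S (w q), fun q hq => ?_⟩
  rcases hwq : w q with _ | ⟨l, v⟩
  · have := hw q
    rw [hwq] at this
    exact absurd this.symm (by simpa [W] using hq)
  · have h1 := hw q
    rw [hwq] at h1
    refine ⟨(v.map (letter b)).prod • ((1 : G) : G ⧸ H), l, ?_, ?_, ?_⟩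
    · refine lt_of_le_of_lt (hmin _ v rfl) ?_
      simp only [hwq, cost, Prod.Lex.toLex_lt_toLex]
      by_cases hl : l.1 ∈ S <;> simp [hl]
    · rw [← mul_smul, ← List.prod_cons, ← List.map_cons]
      exact h1.symm
    · rintro ⟨a, ha, hqa⟩
      obtain ⟨u, hu, hua⟩ := exists_word b S a ha
      have h2 := hmin q u (by simp only [W, Set.mem_ofPred_eq, hua, hqa])
      have h3 : (l :: v).countP (fun l => decide (l.1 ∉ S)) = 0 := by
        have h4 : u.countP (fun l => decide (l.1 ∉ S)) = 0 := by
          rw [List.countP_eq_zero]; intro l hl; simpa using hu l hl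
        rw [hwq] at h2
        simp only [cost, Prod.Lex.toLex_le_toLex] at h2
        omega
      rw [List.countP_eq_zero] at h3
      refine ⟨by simpa using h3 l (by simp), _, word_mem b S v ?_, rfl⟩
      intro l' hl'
      simpa using h3 l' (by simp [hl'])

lemma exists_transversal {X : Type} (b : X → G) (hb : closure (Set.range b) = ⊤) (S : Set X)
    (H : Subgroup G) :
    ∃ (ρ : G ⧸ H → ℕ ×ₗ ℕ) (t : G ⧸ H → G), t ((1 : G) : G ⧸ H) = 1 ∧
      (∀ q, t q • ((1 : G) : G ⧸ H) = q) ∧ (∀ q ∈ orb b S H, t q ∈ closure (b '' S)) ∧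
      ∀ q : G ⧸ H, q ≠ ((1 : G) : G ⧸ H) →
      ∃ (q' : G ⧸ H) (l : X × Bool), ρ q' < ρ q ∧ q = letter b l • q' ∧
        t q = letter b l * t q' := by
  classical
  obtain ⟨ρ, hρ⟩ := exists_parent b hb S H
  choose p l h1 h2 h3 using hρ
  have wf : WellFounded (fun v w : G ⧸ H => ρ v < ρ w) := InvImage.wf ρ wellFounded_lt
  let t : G ⧸ H → G := wf.fix (fun q rec =>
    if h : q = ((1 : G) : G ⧸ H) then 1 else letter b (l q h) * rec (p q h) (h1 q h))
  have t0 : t ((1 : G) : G ⧸ H) = 1 := by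
    simp only [t]; rw [wf.fix_eq]; simp
  have t1 : ∀ q (h : q ≠ ((1 : G) : G ⧸ H)), t q = letter b (l q h) * t (p q h) := by
    intro q h
    simp only [t]; rw [wf.fix_eq]; simp [h]
  refine ⟨ρ, t, t0, ?_, ?_, fun q hq => ⟨p q hq, l q hq, h1 q hq, h2 q hq, t1 q hq⟩⟩
  · intro q
    induction q using wf.induction with
    | _ q ih =>
      by_cases h : q = ((1 : G) : G ⧸ H)
      · rw [h, t0, one_smul]
      · rw [t1 q h, mul_smul, ih _ (h1 q h), ← h2 q h]
  · intro q
    induction q using wf.induction with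
    | _ q ih =>
      intro hq
      by_cases h : q = ((1 : G) : G ⧸ H)
      · rw [h, t0]; exact one_mem _
      · rw [t1 q h]
        refine mul_mem ?_ (ih _ (h1 q h) (h3 q h hq).2)
        have := word_mem b S [l q h] (by simpa using (h3 q h hq).1)
        simpa using this

/-- Schreier generators generate. -/
lemma schreier_mem {X : Type} (b : X → G) (S : Set X) (H : Subgroup G) (t : G ⧸ H → G)
    (D : Subgroup G)
    (hD : ∀ x ∈ S, ∀ q ∈ orb b S H, (t (b x • q))⁻¹ * b x * t q ∈ D)
    (g : G) (hg : g ∈ closure (b '' S)) :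
    ∀ q ∈ orb b S H, (t (g • q))⁻¹ * g * t q ∈ D := by
  have horb : ∀ g ∈ closure (b '' S), ∀ q ∈ orb b S H, g • q ∈ orb b S H := by
    rintro g hg q ⟨a, ha, rfl⟩
    exact ⟨g * a, mul_mem hg ha, by rw [mul_smul]⟩
  induction hg using Subgroup.closure_induction with
  | mem x hx =>
    obtain ⟨i, hi, rfl⟩ := hx
    exact hD i hi
  | one => intro q _; simp
  | mul x y hxm hym hx hy =>
    intro q hq
    have h1 := mul_mem (hx (y • q) (horb y hym q hq)) (hy q hq)
    rw [← mul_smul] at h1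
    convert h1 using 1
    group
  | inv x hxm hx =>
    intro q hq
    have h1 := inv_mem (hx (x⁻¹ • q) (horb _ (inv_mem hxm) q hq))
    rw [smul_inv_smul] at h1
    convert h1 using 1
    group

theorem kurosh {X : Type} (b : X → G) (hb : IsFreeBasis b) (S : Set X) (H : Subgroup G) :
    ∃ (J : Type) (β : J → G) (T : Set J), IsBasisOf β H ∧
      closure (β '' T) = closure (b '' S) ⊓ H := by
  classical
  change Function.Bijective _ at hb
  have hcl : closure (Set.range b) = ⊤ :=
    FreeGroup.lift_surjective_iff_closure_range_eq_top.1 hb.2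
  obtain ⟨ρ, t, t0, tq, tA, tree⟩ := exists_transversal b hcl S H
  let c : X × (G ⧸ H) → G := fun e => (t (b e.1 • e.2))⁻¹ * b e.1 * t e.2
  have memH : ∀ g : G, g • ((1 : G) : G ⧸ H) = ((1 : G) : G ⧸ H) ↔ g ∈ H := by
    intro g
    rw [MulAction.Quotient.smul_coe, smul_eq_mul, mul_one, QuotientGroup.eq]
    simp
  have cH : ∀ e, c e ∈ H := by
    intro e
    rw [← memH]
    simp only [c, mul_smul, tq]
    rw [inv_smul_eq_iff, tq]
  let J := {e : X × (G ⧸ H) // c e ≠ 1}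
  let β : J → G := fun e => c e.1
  let T : Set J := {e | e.1.1 ∈ S ∧ e.1.2 ∈ orb b S H}
  have oorb : ∀ S : Set X, ((1 : G) : G ⧸ H) ∈ orb b S H := fun S => ⟨1, one_mem _, by simp⟩
  have gen : ∀ (S' : Set X) (D : Subgroup G),
      (∀ e : J, e.1.1 ∈ S' → e.1.2 ∈ orb b S' H → β e ∈ D) →
      closure (b '' S') ⊓ H ≤ D := by
    rintro S' D hD h ⟨hA, hH⟩
    have h1 := schreier_mem b S' H t D ?_ h hA _ (oorb S')
    · rw [(memH h).2 hH, t0] at h1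
      simpa using h1
    · intro x hx q hq
      by_cases h0 : c (x, q) = 1
      · change c (x, q) ∈ D
        rw [h0]; exact one_mem _
      · exact hD ⟨(x, q), h0⟩ hx hq
  refine ⟨J, β, T, ⟨?_, ?_⟩, ?_⟩
  · -- injectivity
    let K := FreeGroup J
    let k : X × (G ⧸ H) → K := fun e => if h : c e ≠ 1 then FreeGroup.of ⟨e, h⟩ else 1
    let σ : X → Equiv.Perm ((G ⧸ H) × K) := fun x =>
      { toFun := fun p => (b x • p.1, k (x, p.1) * p.2)
        invFun := fun p => ((b x)⁻¹ • p.1, (k (x, (b x)⁻¹ • p.1))⁻¹ * p.2)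
        left_inv := fun p => by ext <;> simp [K]
        right_inv := fun p => by ext <;> simp [K] }
    let φ : G →* Equiv.Perm ((G ⧸ H) × K) :=
      (FreeGroup.lift σ).comp (MulEquiv.ofBijective (FreeGroup.lift b) hb).symm.toMonoidHom
    have φb : ∀ x, φ (b x) = σ x := by
      intro x
      have : (MulEquiv.ofBijective (FreeGroup.lift b) hb).symm (b x) = FreeGroup.of x := by
        rw [MulEquiv.symm_apply_eq]; simp
      simp [φ, this]
    have φt : ∀ q μ, φ (t q) (((1 : G) : G ⧸ H), μ) = (q, μ) := by
      intro q μ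
      have wf : WellFounded (fun v w : G ⧸ H => ρ v < ρ w) := InvImage.wf ρ wellFounded_lt
      induction q using wf.induction with
      | _ q ih =>
        by_cases h : q = ((1 : G) : G ⧸ H)
        · rw [h, t0]; simp
        · obtain ⟨q', ⟨x, ε⟩, hr, hq, ht⟩ := tree q h
          rw [ht, map_mul, Equiv.Perm.mul_apply, ih q' hr]
          cases ε
          · simp only [letter, cond_false] at hq ht ⊢
            have hq' : q' = b x • q := by rw [hq]; simp
            have hc : c (x, q) = 1 := by
              simp only [c]; rw [← hq', ht]; group
            have hk : k (x, q) = 1 := by simp [k, hc]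
            rw [map_inv, Equiv.Perm.inv_eq_iff_eq, φb]
            simp [σ, hk, hq']
          · simp only [letter, cond_true] at hq ht ⊢
            have hc : c (x, q') = 1 := by
              simp only [c]; rw [← hq, ht]; group
            have hk : k (x, q') = 1 := by simp [k, hc]
            rw [φb]
            simp [σ, hk, hq]
    have φc : ∀ e : J, ∀ μ, φ (β e) (((1 : G) : G ⧸ H), μ) =
        (((1 : G) : G ⧸ H), FreeGroup.of e * μ) := by
      intro e μ
      have hk : k e.1 = FreeGroup.of e := by
        simp only [k]; rw [dif_pos e.2]
      simp only [β, c, map_mul, map_inv, Equiv.Perm.mul_apply]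
      rw [φt, Equiv.Perm.inv_eq_iff_eq, φt, φb]
      simp only [σ, Equiv.coe_fn_mk, Prod.mk.eta, hk]
    have φL : ∀ κ : K, ∀ μ, φ (FreeGroup.lift β κ) (((1 : G) : G ⧸ H), μ) =
        (((1 : G) : G ⧸ H), κ * μ) := by
      intro κ
      induction κ using FreeGroup.induction_on with
      | C1 => intro μ; simp
      | of e => intro μ; rw [FreeGroup.lift_apply_of]; exact φc e μ
      | inv_of e _ =>
        intro μ
        rw [map_inv, map_inv, FreeGroup.lift_apply_of, Equiv.Perm.inv_eq_iff_eq, φc e]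
        simp
      | mul x y hx hy =>
        intro μ
        rw [map_mul, map_mul, Equiv.Perm.mul_apply, hy, hx, mul_assoc]
    rw [injective_iff_map_eq_one]
    intro κ hκ
    have := φL κ 1
    rw [hκ] at this
    simpa using this.symm
  · apply le_antisymm
    · rw [closure_le]
      rintro _ ⟨e, rfl⟩
      exact cH e.1
    · have := gen Set.univ (closure (Set.range β)) (fun e _ _ => subset_closure ⟨e, rfl⟩)
      simpa [hcl] using this
  · apply le_antisymm
    · rw [closure_le]
      rintro _ ⟨e, ⟨he1, he2⟩, rfl⟩
      refine Subgroup.mem_inf.2 ⟨?_, cH e.1⟩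
      have hx : b e.1.1 ∈ closure (b '' S) := subset_closure ⟨_, he1, rfl⟩
      refine mul_mem (mul_mem (inv_mem (tA _ ?_)) hx) (tA _ he2)
      obtain ⟨a, ha, hq⟩ := he2
      exact ⟨b e.1.1 * a, mul_mem hx ha, by rw [mul_smul, ← hq]⟩
    · exact gen S _ (fun e h1 h2 => subset_closure ⟨e, ⟨h1, h2⟩, rfl⟩)

lemma IsBasisOf.equiv {J : Type} {β : J → G} {H : Subgroup G} (h : IsBasisOf β H) :
    ∃ e : FreeGroup J ≃* H, ∀ x, (e x : G) = FreeGroup.lift β x := by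
  have hr : (FreeGroup.lift β).range = H := by
    rw [FreeGroup.range_lift_eq_closure]; exact h.2
  refine ⟨(MonoidHom.ofInjective h.1).trans (MulEquiv.subgroupCongr hr), fun x => ?_⟩
  rfl

lemma IsBasisOf.reindex {I J : Type} {β : I → G} {H : Subgroup G} (h : IsBasisOf β H)
    (e : J ≃ I) : IsBasisOf (β ∘ e) H := by
  refine ⟨?_, ?_⟩
  · have : FreeGroup.lift (β ∘ e) =
        (FreeGroup.lift β).comp (FreeGroup.freeGroupCongr e).toMonoidHom := by
      ext x; simp
    rw [this]
    exact h.1.comp (FreeGroup.freeGroupCongr e).injective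
  · rw [EquivLike.range_comp]; exact h.2

lemma IsBasisOf.comp {I J : Type} {β : I → G} {H : Subgroup G} (h : IsBasisOf β H)
    (f : J → I) (hf : Function.Injective f) :
    IsBasisOf (β ∘ f) (closure (Set.range (β ∘ f))) := by
  refine ⟨?_, rfl⟩
  have : FreeGroup.lift (β ∘ f) = (FreeGroup.lift β).comp (FreeGroup.map f) := by
    ext x; simp
  rw [this]
  exact h.1.comp (FreeGroup.map_injective hf)

lemma IsBasisOf.hasRank {r : ℕ} {β : Fin r → G} {H : Subgroup G} (h : IsBasisOf β H) :
    HasRank H r := by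
  obtain ⟨e, -⟩ := IsBasisOf.equiv h
  exact ⟨e⟩

lemma HasRank.index {r : ℕ} {J : Type} {β : J → G} {H : Subgroup G} (h : IsBasisOf β H)
    (hr : HasRank H r) : Nonempty (J ≃ Fin r) := by
  obtain ⟨e, -⟩ := IsBasisOf.equiv h
  obtain ⟨f⟩ := hr
  exact ⟨Equiv.ofFreeGroupEquiv (e.trans f.symm)⟩

lemma HasRank.unique {r s : ℕ} {H : Subgroup G} (hr : HasRank H r) (hs : HasRank H s) :
    r = s := by
  obtain ⟨e⟩ := hr
  obtain ⟨f⟩ := hs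
  simpa using Fintype.card_congr (Equiv.ofFreeGroupEquiv (e.trans f.symm))

/-- Basis exchange. -/
lemma exchange {I I' K : Type} {α : I → G} {γ : K → G} {a : I' → G} {A H : Subgroup G}
    (h : IsBasisOf (Sum.elim α γ) H) (hα : closure (Set.range α) = A) (ha : IsBasisOf a A) :
    IsBasisOf (Sum.elim a γ) H := by
  have hα' : IsBasisOf α A := by
    have := IsBasisOf.comp h Sum.inl Sum.inl_injective
    rw [Sum.elim_comp_inl, hα] at this
    exact this
  obtain ⟨e1, he1⟩ := IsBasisOf.equiv hα'
  obtain ⟨e2, he2⟩ := IsBasisOf.equiv ha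
  let e : FreeGroup I' ≃* FreeGroup I := e2.trans e1.symm
  have he : ∀ x, FreeGroup.lift α (e x) = FreeGroup.lift a x := by
    intro x
    rw [← he1, ← he2]; simp [e]
  let E : FreeGroup (I' ⊕ K) →* FreeGroup (I ⊕ K) :=
    FreeGroup.lift (Sum.elim (fun i => FreeGroup.map Sum.inl (e (FreeGroup.of i)))
      (fun k => FreeGroup.of (Sum.inr k)))
  let E' : FreeGroup (I ⊕ K) →* FreeGroup (I' ⊕ K) :=
    FreeGroup.lift (Sum.elim (fun i => FreeGroup.map Sum.inl (e.symm (FreeGroup.of i)))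
      (fun k => FreeGroup.of (Sum.inr k)))
  have hE' : E'.comp (FreeGroup.map Sum.inl) =
      (FreeGroup.map Sum.inl).comp e.symm.toMonoidHom := by
    ext i; simp [E']
  have hE : E'.comp E = MonoidHom.id _ := by
    ext i
    rcases i with i | k
    · have := DFunLike.congr_fun hE' (e (FreeGroup.of i))
      simpa [E] using this
    · simp [E, E']
  have hl : (FreeGroup.lift (Sum.elim α γ)).comp (FreeGroup.map Sum.inl) = FreeGroup.lift α := by
    ext i; simp
  have hL : FreeGroup.lift (Sum.elim a γ) = (FreeGroup.lift (Sum.elim α γ)).comp E := by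
    ext i
    rcases i with i | k
    · have := DFunLike.congr_fun hl (e (FreeGroup.of i))
      rw [he] at this
      simpa [E] using this.symm
    · simp [E]
  refine ⟨?_, ?_⟩
  · rw [hL]
    refine h.1.comp ?_
    exact Function.LeftInverse.injective (g := E') (fun x => DFunLike.congr_fun hE x)
  · rw [Set.Sum.elim_range, Subgroup.closure_union, ha.2, ← hα, ← Subgroup.closure_union,
      ← Set.Sum.elim_range]
    exact h.2

/-- `A` is a free factor of `H`, in terms of bases. -/
def FF (A H : Subgroup G) : Prop :=
  ∃ (I K : Type) (α : I → G) (γ : K → G), IsBasisOf (Sum.elim α γ) H ∧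
    closure (Set.range α) = A

lemma FF.le {A H : Subgroup G} (h : FF A H) : A ≤ H := by
  obtain ⟨I, K, α, γ, h, rfl⟩ := h
  rw [← h.2]
  apply Subgroup.closure_mono
  rintro _ ⟨i, rfl⟩
  exact ⟨Sum.inl i, rfl⟩

lemma FF.of_set {J : Type} {β : J → G} {H : Subgroup G} (h : IsBasisOf β H) (S : Set J) :
    FF (closure (β '' S)) H := by
  classical
  refine ⟨S, (Sᶜ : Set J), fun i => β i, fun i => β i, ?_, ?_⟩
  · convert IsBasisOf.reindex h (Equiv.Set.sumCompl S) using 1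
    ext i
    rcases i with i | i <;> simp
  · congr 1
    ext x; simp

lemma FF.basis {A H : Subgroup G} (h : FF A H) {I' : Type} {a : I' → G} (ha : IsBasisOf a A) :
    ∃ (K : Type) (γ : K → G), IsBasisOf (Sum.elim a γ) H := by
  obtain ⟨I, K, α, γ, h, hA⟩ := h
  exact ⟨K, γ, exchange h hA ha⟩

lemma FF.trans {A B H : Subgroup G} (h : FF A B) (h' : FF B H) : FF A H := by
  obtain ⟨I, K, α, γ, h, rfl⟩ := h
  obtain ⟨L, δ, hL⟩ := FF.basis h' h
  have := FF.of_set hL (Sum.inl '' (Set.range Sum.inl))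
  convert this using 2
  ext x; simp

lemma FF.inf {A : Subgroup G} (h : FF A ⊤) (H : Subgroup G) : FF (A ⊓ H) H := by
  obtain ⟨I, K, α, γ, h, rfl⟩ := h
  have hb : IsFreeBasis (Sum.elim α γ) :=
    ⟨h.1, FreeGroup.lift_surjective_iff_closure_range_eq_top.2 h.2⟩
  obtain ⟨J, β, T, h1, h2⟩ := kurosh _ hb (Set.range Sum.inl) H
  have := FF.of_set h1 T
  rw [h2] at this
  convert this using 3
  ext x; simp

lemma FF.rank {A H : Subgroup G} (h : FF A H) {r : ℕ} (hr : HasRank H r) :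
    ∃ s ≤ r, HasRank A s := by
  obtain ⟨I, K, α, γ, h, hA⟩ := h
  obtain ⟨e⟩ := HasRank.index h hr
  have hα : IsBasisOf α A := by
    have := IsBasisOf.comp h Sum.inl Sum.inl_injective
    rw [Sum.elim_comp_inl, hA] at this
    exact this
  have hf : Function.Injective (e ∘ Sum.inl : I → Fin r) := e.injective.comp Sum.inl_injective
  have : Finite I := Finite.of_injective _ hf
  obtain ⟨s, ⟨es⟩⟩ := Finite.exists_equiv_fin I
  refine ⟨s, ?_, IsBasisOf.hasRank (IsBasisOf.reindex hα es.symm)⟩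
  simpa using Fintype.card_le_of_injective _ (hf.comp es.symm.injective)

lemma FF.rank_le {A H : Subgroup G} (h : FF A H) {r s : ℕ} (hr : HasRank H r)
    (hs : HasRank A s) : s ≤ r := by
  obtain ⟨s', hs', h'⟩ := FF.rank h hr
  rw [HasRank.unique hs h']; exact hs'

lemma FF.finBasis {A H : Subgroup G} (h : FF A H) {r m : ℕ} (hr : HasRank H r)
    {a : Fin m → G} (ha : IsBasisOf a A) :
    ∃ (l : ℕ) (γ : Fin l → G), IsBasisOf (Fin.append a γ) H := by
  obtain ⟨K, γ, hγ⟩ := FF.basis h ha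
  obtain ⟨e⟩ := HasRank.index hγ hr
  have : Finite K := Finite.of_injective _ (e.injective.comp Sum.inr_injective)
  obtain ⟨l, ⟨f⟩⟩ := Finite.exists_equiv_fin K
  refine ⟨l, γ ∘ f.symm, ?_⟩
  convert IsBasisOf.reindex hγ
    (finSumFinEquiv.symm.trans (Equiv.sumCongr (Equiv.refl _) f.symm)) using 1
  ext i
  refine Fin.addCases (fun i => ?_) (fun i => ?_) i <;> simp

lemma FF.prefixFactor {m : ℕ} {a : Fin m → G} {A : Subgroup G} (h : IsBasisOf a A) (i : ℕ) :
    FF (prefixSubgroup a i) A := FF.of_set h _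

lemma prefix_mono {m : ℕ} (a : Fin m → G) {i j : ℕ} (h : i ≤ j) :
    prefixSubgroup a i ≤ prefixSubgroup a j :=
  Subgroup.closure_mono (Set.image_mono (fun _ hx => lt_of_lt_of_le hx h))

lemma prefix_full {m : ℕ} (a : Fin m → G) {i : ℕ} (h : m ≤ i) :
    prefixSubgroup a i = closure (Set.range a) := by
  rw [← Set.image_univ]
  unfold prefixSubgroup
  congr 2
  ext x
  simp only [Set.mem_ofPred_eq, Set.mem_univ, iff_true]
  exact lt_of_lt_of_le x.2 h

lemma prefix_append {m l : ℕ} (a : Fin m → G) (γ : Fin l → G) {i : ℕ} (h : i ≤ m) :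
    prefixSubgroup (Fin.append a γ) i = prefixSubgroup a i := by
  unfold prefixSubgroup
  congr 1
  ext x
  constructor
  · rintro ⟨j, hj, rfl⟩
    revert hj
    refine Fin.addCases (fun j => ?_) (fun j => ?_) j
    · intro hj
      exact ⟨j, by simpa using hj, by simp⟩
    · intro hj
      simp at hj
      omega
  · rintro ⟨j, hj, rfl⟩
    exact ⟨Fin.castAdd l j, by simpa using hj, by simp⟩

lemma prefix_zero {m : ℕ} (a : Fin m → G) : prefixSubgroup a 0 = ⊥ := by
  simp [prefixSubgroup]

/-- Relative echelon bases inside the ambient group. -/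
def EchB {m : ℕ} (a : Fin m → G) (A H : Subgroup G) : Prop :=
  IsBasisOf a A ∧ ∀ i < m, ∃ r r' : ℕ,
    HasRank (H ⊓ prefixSubgroup a i) r' ∧
    HasRank (H ⊓ prefixSubgroup a (i + 1)) r ∧ r ≤ r' + 1

lemma isEchelon_iff_top (H : Subgroup G) :
    IsEchelon H ↔ ∃ (m : ℕ) (b : Fin m → G), EchB b ⊤ H := by
  unfold IsEchelon IsEchelonBasis EchB
  refine exists_congr fun m => exists_congr fun b => and_congr ?_ ?_
  · unfold IsFreeBasis IsBasisOf Function.Bijective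
    rw [FreeGroup.lift_surjective_iff_closure_range_eq_top]
  · exact ⟨fun h i hi => h ⟨i, hi⟩, fun h i => h i i.2⟩

lemma hasRank_map {G' : Type} [Group G'] (f : G' →* G) (hf : Function.Injective f)
    (H : Subgroup G') (r : ℕ) : HasRank (H.map f) r ↔ HasRank H r := by
  have e : H ≃* H.map f := H.equivMapOfInjective f hf
  exact ⟨fun ⟨g⟩ => ⟨g.trans e.symm⟩, fun ⟨g⟩ => ⟨g.trans e⟩⟩

lemma basis_map {A : Subgroup G} {I : Type} (b : I → A) :
    IsBasisOf (fun i => (b i : G)) A ↔ IsBasisOf b ⊤ := by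
  have h1 : FreeGroup.lift (fun i => (b i : G)) = A.subtype.comp (FreeGroup.lift b) := by
    ext i; simp
  have h2 : closure (Set.range (fun i => (b i : G))) = (closure (Set.range b)).map A.subtype := by
    rw [MonoidHom.map_closure, ← Set.range_comp]; rfl
  unfold IsBasisOf
  rw [h1, h2]
  refine and_congr ?_ ?_
  · rw [MonoidHom.coe_comp]
    exact Function.Injective.of_comp_iff A.subtype_injective _
  · constructor
    · intro h
      apply Subgroup.map_injective A.subtype_injective
      rw [h, ← MonoidHom.range_eq_map, Subgroup.range_subtype]
    · intro h
      rw [h, ← MonoidHom.range_eq_map, Subgroup.range_subtype]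

lemma echB_map {H A : Subgroup G} (hHA : H ≤ A) {m : ℕ} (b : Fin m → A) :
    EchB (fun i => (b i : G)) A H ↔ EchB b ⊤ (H.subgroupOf A) := by
  unfold EchB
  rw [basis_map]
  have key : ∀ i, H ⊓ prefixSubgroup (fun i => (b i : G)) i =
      (H.subgroupOf A ⊓ prefixSubgroup b i).map A.subtype := by
    intro i
    have h1 : prefixSubgroup (fun i => (b i : G)) i = (prefixSubgroup b i).map A.subtype := by
      unfold prefixSubgroup
      rw [MonoidHom.map_closure, ← Set.image_comp]; rfl
    rw [h1, Subgroup.map_inf _ _ _ A.subtype_injective, Subgroup.map_subgroupOf_eq_of_le hHA]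
  simp only [key, hasRank_map _ A.subtype_injective]

lemma isEchelon_sub {H A : Subgroup G} (hHA : H ≤ A) :
    IsEchelon (H.subgroupOf A) ↔ ∃ (m : ℕ) (a : Fin m → G), EchB a A H := by
  rw [isEchelon_iff_top]
  constructor
  · rintro ⟨m, b, h⟩
    exact ⟨m, _, (echB_map hHA b).2 h⟩
  · rintro ⟨m, a, h⟩
    have hm : ∀ i, a i ∈ A := fun i => by
      rw [← h.1.2]; exact subset_closure ⟨i, rfl⟩
    exact ⟨m, fun i => ⟨a i, hm i⟩, (echB_map hHA _).1 h⟩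

lemma hasRank_of_fg [IsFreeGroup G] (H : Subgroup G) (hH : H.FG) : ∃ r, HasRank H r := by
  have b := IsFreeGroup.basis H
  have hfg : Group.FG (FreeGroup (IsFreeGroup.Generators H)) := by
    have : Group.FG H := (Group.fg_iff_subgroup_fg H).2 hH
    exact Group.fg_of_surjective (f := b.repr.toMonoidHom) b.repr.surjective
  have : Finite (IsFreeGroup.Generators H) := by
    have h1 : Group.FG (Abelianization (FreeGroup (IsFreeGroup.Generators H))) :=
      Group.fg_of_surjective (f := Abelianization.of) (QuotientGroup.mk_surjective)
    have h2 : AddGroup.FG (FreeAbelianGroup (IsFreeGroup.Generators H)) :=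
      GroupFG.iff_add_fg.1 h1
    have h3 : Module.Finite ℤ (FreeAbelianGroup (IsFreeGroup.Generators H)) :=
      Module.Finite.iff_addGroup_fg.2 h2
    exact Module.Finite.finite_basis (FreeAbelianGroup.basis _)
  obtain ⟨r, ⟨e⟩⟩ := Finite.exists_equiv_fin (IsFreeGroup.Generators H)
  exact ⟨r, ⟨(FreeGroup.freeGroupCongr e.symm).trans b.repr.symm⟩⟩

lemma closure_basis {A : Subgroup G} {I : Type} (b : FreeGroupBasis I A) :
    closure (Set.range (fun i => (b i : G))) = A := by
  have h1 : FreeGroup.lift b = b.repr.symm.toMonoidHom := by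
    ext i; simp; rfl
  have h : IsBasisOf b ⊤ := by
    refine ⟨?_, ?_⟩
    · rw [h1]; exact b.repr.symm.injective
    · rw [← FreeGroup.lift_surjective_iff_closure_range_eq_top, h1]
      exact b.repr.symm.surjective
  exact ((basis_map _).2 h).2

lemma FF.of_isFreeFactor [IsFreeGroup G] {A : Subgroup G} (hA : IsFreeFactor A) : FF A ⊤ := by
  obtain ⟨B, hB⟩ := hA
  have bA := IsFreeGroup.basis A
  have bB := IsFreeGroup.basis B
  refine ⟨_, _, fun i => (bA i : G), fun i => (bB i : G), ⟨?_, ?_⟩, ?_⟩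
  · let e := MulEquiv.ofBijective _ hB
    let ψ : Monoid.Coprod A B →* FreeGroup (IsFreeGroup.Generators A ⊕ IsFreeGroup.Generators B) :=
      Monoid.Coprod.lift ((FreeGroup.map Sum.inl).comp bA.repr.toMonoidHom)
        ((FreeGroup.map Sum.inr).comp bB.repr.toMonoidHom)
    have h : (ψ.comp e.symm.toMonoidHom).comp
        (FreeGroup.lift (Sum.elim (fun i => (bA i : G)) (fun i => (bB i : G)))) =
        MonoidHom.id _ := by
      ext i
      rcases i with i | i
      · have : e.symm (bA i : G) = Monoid.Coprod.inl (bA i) := by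
          rw [MulEquiv.symm_apply_eq]; simp [e]
        simp [this, ψ]
      · have : e.symm (bB i : G) = Monoid.Coprod.inr (bB i) := by
          rw [MulEquiv.symm_apply_eq]; simp [e]
        simp [this, ψ]
    exact Function.LeftInverse.injective (g := ψ.comp e.symm.toMonoidHom)
      (fun x => DFunLike.congr_fun h x)
  · rw [Set.Sum.elim_range, Subgroup.closure_union, closure_basis, closure_basis]
    have := Monoid.Coprod.range_lift A.subtype B.subtype
    rw [MonoidHom.range_eq_top.2 hB.2, Subgroup.range_subtype, Subgroup.range_subtype] at this
    exact this.symm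
  · exact closure_basis bA

/-- Extending an echelon basis from a free factor to the whole group. -/
lemma echB_extend {H A : Subgroup G} (hHA : H ≤ A) (hA : FF A ⊤) {n r : ℕ}
    (hn : HasRank (⊤ : Subgroup G) n) (hr : HasRank H r) {m : ℕ} {a : Fin m → G}
    (ha : EchB a A H) : ∃ (m' : ℕ) (a' : Fin m' → G), EchB a' ⊤ H := by
  obtain ⟨l, γ, hγ⟩ := FF.finBasis hA hn ha.1
  refine ⟨_, _, hγ, fun i _ => ?_⟩
  by_cases him : i < m
  · rw [prefix_append a γ him.le, prefix_append a γ (Nat.succ_le_of_lt him)]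
    exact ha.2 i him
  · have key : ∀ j, m ≤ j → H ⊓ prefixSubgroup (Fin.append a γ) j = H := by
      intro j hj
      rw [inf_eq_left]
      refine hHA.trans (le_trans ?_ (prefix_mono _ hj))
      rw [prefix_append a γ le_rfl, prefix_full a le_rfl, ha.1.2]
    rw [key i (by omega), key (i + 1) (by omega)]
    exact ⟨r, r, hr, hr, by omega⟩

/-- Restricting an echelon basis to a free factor, step by step. -/
lemma echB_restrict {H A : Subgroup G} (hHA : H ≤ A) (hA : FF A ⊤) {n : ℕ}
    (hn : HasRank (⊤ : Subgroup G) n) {N : ℕ} {b : Fin N → G}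
    (hb : EchB b ⊤ H) (i : ℕ) (hi : i ≤ N) :
    ∃ (m : ℕ) (a : Fin m → G), EchB a (A ⊓ prefixSubgroup b i) H := by
  induction i with
  | zero =>
    refine ⟨0, Fin.elim0, ⟨?_, ?_⟩, fun i hi => absurd hi (by omega)⟩
    · exact Function.injective_of_subsingleton _
    · rw [prefix_zero]; simp [Set.range_eq_empty]
  | succ i ih =>
    obtain ⟨m, a, ha⟩ := ih (by omega)
    have hP : ∀ j, FF (prefixSubgroup b j) ⊤ := fun j => FF.prefixFactor hb.1 j
    have hPle : prefixSubgroup b i ≤ prefixSubgroup b (i + 1) := prefix_mono b (Nat.le_succ i)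
    -- the next subgroup is a free factor of the ambient group
    have hA1 : FF (A ⊓ prefixSubgroup b (i + 1)) ⊤ :=
      FF.trans (FF.inf hA _) (hP (i + 1))
    obtain ⟨k, -, hk⟩ := FF.rank hA1 hn
    have hAA : FF (A ⊓ prefixSubgroup b i) (A ⊓ prefixSubgroup b (i + 1)) := by
      have := FF.inf (hP i) (A ⊓ prefixSubgroup b (i + 1))
      have e : prefixSubgroup b i ⊓ (A ⊓ prefixSubgroup b (i + 1)) = A ⊓ prefixSubgroup b i := by
        rw [inf_left_comm, inf_eq_left.2 hPle]
      rwa [e] at this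
    obtain ⟨l, γ, hγ⟩ := FF.finBasis hAA hk ha.1
    refine ⟨_, _, hγ, fun j _ => ?_⟩
    by_cases hjm : j < m
    · rw [prefix_append a γ hjm.le, prefix_append a γ (Nat.succ_le_of_lt hjm)]
      exact ha.2 j hjm
    · obtain ⟨r, r', hr', hr, hle⟩ := hb.2 i (by omega)
      have hD : ∀ j, FF (prefixSubgroup (Fin.append a γ) j) ⊤ := fun j =>
        FF.trans (FF.prefixFactor hγ j) hA1
      have hDle : ∀ j, prefixSubgroup (Fin.append a γ) j ≤ prefixSubgroup b (i + 1) := fun j =>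
        (FF.le (FF.prefixFactor hγ j)).trans inf_le_right
      have hDr : ∀ j, FF (H ⊓ prefixSubgroup (Fin.append a γ) j)
          (H ⊓ prefixSubgroup b (i + 1)) := by
        intro j
        have := FF.inf (hD j) (H ⊓ prefixSubgroup b (i + 1))
        rwa [inf_left_comm, inf_eq_left.2 (hDle j)] at this
      have hDl : FF (H ⊓ prefixSubgroup b i) (H ⊓ prefixSubgroup (Fin.append a γ) j) := by
        have := FF.inf (hP i) (H ⊓ prefixSubgroup (Fin.append a γ) j)
        have e : prefixSubgroup b i ⊓ (H ⊓ prefixSubgroup (Fin.append a γ) j) =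
            H ⊓ prefixSubgroup b i := by
          apply le_antisymm
          · exact le_inf (inf_le_right.trans inf_le_left) inf_le_left
          · refine le_inf inf_le_right (le_inf inf_le_left ?_)
            refine le_trans ?_ (prefix_mono _ (not_lt.1 hjm))
            rw [prefix_append a γ le_rfl, prefix_full a le_rfl, ha.1.2]
            exact inf_le_inf_right _ hHA
        rwa [e] at this
      obtain ⟨s', -, hs'⟩ := FF.rank (hDr j) hr
      obtain ⟨s, hs, hs2⟩ := FF.rank (hDr (j + 1)) hr
      have := FF.rank_le hDl hs' hr'
      exact ⟨s, s', hs', hs2, by omega⟩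

end Ech

theorem statement10 {n : ℕ} (H A : Subgroup (FreeGroup (Fin n))) (hH : H.FG)
    (hA : IsFreeFactor A) (hHA : H ≤ A) :
    IsEchelon H ↔ IsEchelon (H.subgroupOf A) := by
  have hFF := Ech.FF.of_isFreeFactor hA
  have hn : HasRank (⊤ : Subgroup (FreeGroup (Fin n))) n := ⟨Subgroup.topEquiv.symm⟩
  obtain ⟨r, hr⟩ := Ech.hasRank_of_fg H hH
  rw [Ech.isEchelon_sub hHA, Ech.isEchelon_iff_top]
  constructor
  · rintro ⟨N, b, hb⟩
    have := Ech.echB_restrict hHA hFF hn hb N le_rfl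
    rwa [Ech.prefix_full b le_rfl, hb.1.2, inf_top_eq] at this
  · rintro ⟨m, a, ha⟩
    exact Ech.echB_extend hHA hFF hn hr ha
end

section
/- Let H ≤ F_n be a non-trivial finitely generated subgroup. Then H is echelon if and only if there exists a free factor A of F_n contained in ff(H) such that rank(H ∩ A) = rank(H) − 1 and H ∩ A is echelon. -/
/-! ### Schreier transversals -/

inductive SchGood {G X : Type} [Group G] (b : X → G) (U : Set G) : G → Prop
  | one : SchGood b U 1
  | step (x : X) (u : G) : SchGood b U u → u ∈ U → b x * u ∈ U → SchGood b U (b x * u)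
  | stepInv (x : X) (u : G) : SchGood b U u → u ∈ U → (b x)⁻¹ * u ∈ U →
      SchGood b U ((b x)⁻¹ * u)

theorem SchGood.mono {G X : Type} [Group G] {b : X → G} {U V : Set G} (h : U ⊆ V) {g : G}
    (hg : SchGood b U g) : SchGood b V g := by
  induction hg with
  | one => exact .one
  | step x u _ hu hu' ih => exact .step x u ih (h hu) (h hu')
  | stepInv x u _ hu hu' ih => exact .stepInv x u ih (h hu) (h hu')

def SchOK {G X : Type} [Group G] (b : X → G) (K : Subgroup G) (U : Set G) : Prop :=
  (∀ u ∈ U, SchGood b U u) ∧ ∀ u ∈ U, ∀ v ∈ U, (u : G ⧸ K) = (v : G ⧸ K) → u = v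

theorem sch_extend {G X : Type} [Group G] (b : X → G) (K : Subgroup G) (A : Subgroup G)
    (Y : Set X) (hY : ∀ y ∈ Y, b y ∈ A) (U₀ : Set G) (h₀ : SchOK b K U₀) (hA₀ : U₀ ⊆ A) :
    ∃ U : Set G, U₀ ⊆ U ∧ SchOK b K U ∧ U ⊆ A ∧ ∀ y ∈ Y, ∀ u ∈ U,
      (∃ v ∈ U, (v : G ⧸ K) = ((b y * u : G) : G ⧸ K)) ∧
      (∃ v ∈ U, (v : G ⧸ K) = (((b y)⁻¹ * u : G) : G ⧸ K)) := by
  obtain ⟨U, hU₀, hmax⟩ := zorn_subset_nonempty {U : Set G | SchOK b K U ∧ U ⊆ A} (by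
    intro c hc hchain hne
    refine ⟨⋃₀ c, ⟨⟨?_, ?_⟩, ?_⟩, fun s hs => Set.subset_sUnion_of_mem hs⟩
    · rintro u ⟨s, hs, hu⟩
      exact ((hc hs).1.1 u hu).mono (Set.subset_sUnion_of_mem hs)
    · rintro u ⟨s, hs, hu⟩ v ⟨t, ht, hv⟩ huv
      rcases hchain.total hs ht with h | h
      · exact (hc ht).1.2 u (h hu) v hv huv
      · exact (hc hs).1.2 u hu v (h hv) huv
    · exact Set.sUnion_subset fun s hs => (hc hs).2) U₀ ⟨h₀, hA₀⟩
  obtain ⟨⟨hOK, hUA⟩, hm⟩ := hmax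
  refine ⟨U, hU₀, hOK, hUA, ?_⟩
  -- adding a new element
  have key : ∀ w : G, w ∈ A → (SchGood b (insert w U) w) →
      ∃ v ∈ U, (v : G ⧸ K) = (w : G ⧸ K) := by
    intro w hwA hw
    by_contra hcon
    push Not at hcon
    have : w ∈ U := by
      refine hm (y := insert w U) ⟨⟨?_, ?_⟩, ?_⟩ (Set.subset_insert _ _) (Set.mem_insert _ _)
      · rintro u (rfl | hu)
        · exact hw
        · exact (hOK.1 u hu).mono (Set.subset_insert _ _)
      · rintro u (rfl | hu) v (rfl | hv) huv
        · rfl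
        · exact absurd huv.symm (hcon v hv)
        · exact absurd huv (hcon u hu)
        · exact hOK.2 u hu v hv huv
      · exact Set.insert_subset hwA hUA
    exact hcon w this rfl
  intro y hy u hu
  constructor
  · refine key _ (A.mul_mem (hY y hy) (hUA hu)) (.step y u ?_ (Set.mem_insert_of_mem _ hu)
      (Set.mem_insert _ _))
    exact (hOK.1 u hu).mono (Set.subset_insert _ _)
  · refine key _ (A.mul_mem (A.inv_mem (hY y hy)) (hUA hu))
      (.stepInv y u ?_ (Set.mem_insert_of_mem _ hu) (Set.mem_insert _ _))
    exact (hOK.1 u hu).mono (Set.subset_insert _ _)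

theorem sch_cover {G X : Type} [Group G] (b : X → G) (K : Subgroup G)
    (Y : Set X) (U : Set G) (hU : ∀ y ∈ Y, ∀ u ∈ U,
      (∃ v ∈ U, (v : G ⧸ K) = ((b y * u : G) : G ⧸ K)) ∧
      (∃ v ∈ U, (v : G ⧸ K) = (((b y)⁻¹ * u : G) : G ⧸ K))) (a : G)
    (ha : a ∈ Subgroup.closure (b '' Y)) (u : G) (hu : u ∈ U) :
    ∃ v ∈ U, (v : G ⧸ K) = ((a * u : G) : G ⧸ K) := by
  have : ∀ u ∈ U, (∃ v ∈ U, (v : G ⧸ K) = ((a * u : G) : G ⧸ K)) ∧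
      (∃ v ∈ U, (v : G ⧸ K) = ((a⁻¹ * u : G) : G ⧸ K)) := by
    have hmul : ∀ (x y : G), (∀ u ∈ U, ∃ v ∈ U, (v : G ⧸ K) = ((x * u : G) : G ⧸ K)) →
        (∀ u ∈ U, ∃ v ∈ U, (v : G ⧸ K) = ((y * u : G) : G ⧸ K)) →
        ∀ u ∈ U, ∃ v ∈ U, (v : G ⧸ K) = ((x * y * u : G) : G ⧸ K) := by
      intro x y hx hy u hu
      obtain ⟨v, hv, h1⟩ := hy u hu
      obtain ⟨w, hw, h2⟩ := hx v hv
      refine ⟨w, hw, ?_⟩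
      have h3 : x • (v : G ⧸ K) = x • ((y * u : G) : G ⧸ K) := by rw [h1]
      rw [h2, mul_assoc]
      exact h3
    induction ha using Subgroup.closure_induction with
    | mem x hx =>
      obtain ⟨y, hy, rfl⟩ := hx
      exact fun u hu => hU y hy u hu
    | one => exact fun u hu => ⟨⟨u, hu, by simp⟩, ⟨u, hu, by simp⟩⟩
    | mul x y _ _ hx hy =>
      refine fun u hu => ⟨hmul x y (fun u hu => (hx u hu).1) (fun u hu => (hy u hu).1) u hu, ?_⟩
      rw [mul_inv_rev]
      exact hmul _ _ (fun u hu => (hy u hu).2) (fun u hu => (hx u hu).2) u hu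
    | inv x _ hx => exact fun u hu => ⟨(hx u hu).2, by simpa using (hx u hu).1⟩
  exact (this u hu).1

theorem sch_exists {G X : Type} [Group G] (b : X → G) (hb : Subgroup.closure (Set.range b) = ⊤)
    (K : Subgroup G) (Y : Set X) :
    ∃ t : G ⧸ K → G, (∀ s, (t s : G ⧸ K) = s) ∧ t ((1 : G) : G ⧸ K) = 1 ∧
      (∀ s, SchGood b (Set.range t) (t s)) ∧
      (∀ a ∈ Subgroup.closure (b '' Y), t (a : G ⧸ K) ∈ Subgroup.closure (b '' Y)) := by
  obtain ⟨U₁, h01, hOK1, hUA1, hc1⟩ := sch_extend b K (Subgroup.closure (b '' Y)) Y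
    (fun y hy => Subgroup.subset_closure ⟨y, hy, rfl⟩) {1}
    ⟨by rintro u rfl; exact .one, by rintro u rfl v rfl _; rfl⟩ (by
      rintro u rfl; exact Subgroup.one_mem _)
  obtain ⟨U, h12, hOK, -, hc⟩ := sch_extend b K ⊤ Set.univ (fun y hy => trivial) U₁ hOK1
    (fun _ _ => trivial)
  have h1 : (1 : G) ∈ U₁ := h01 rfl
  have hcov : ∀ s : G ⧸ K, ∃ v ∈ U, (v : G ⧸ K) = s := by
    intro s
    obtain ⟨g, rfl⟩ := QuotientGroup.mk_surjective s
    have := sch_cover b K Set.univ U hc g (by rw [Set.image_univ, hb]; trivial) 1 (h12 h1)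
    simpa using this
  choose t htU ht using hcov
  have hrange : Set.range t = U := by
    ext u
    constructor
    · rintro ⟨s, rfl⟩; exact htU s
    · intro hu
      exact ⟨(u : G ⧸ K), hOK.2 _ (htU _) _ hu (ht _)⟩
  refine ⟨t, ht, hOK.2 _ (htU _) _ (h12 h1) (ht _), ?_, ?_⟩
  · intro s
    rw [hrange]
    exact hOK.1 _ (htU s)
  · intro a ha
    obtain ⟨v, hv, h⟩ := sch_cover b K Y U₁ hc1 a ha 1 h1
    have : t (a : G ⧸ K) = v := hOK.2 _ (htU _) _ (h12 hv) (by rw [ht, h, mul_one])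
    rw [this]
    exact hUA1 hv

/-! ### Relative free factors described by bases -/

/-- `C` is generated by part of a basis of `K`. -/
def FF {G : Type} [Group G] (C K : Subgroup G) : Prop :=
  ∃ (ι : Type) (s : ι → G) (J : Set ι), IsBasisOf s K ∧ Subgroup.closure (s '' J) = C

theorem isFreeBasis_iff {G : Type} [Group G] {ι : Type} (s : ι → G) :
    IsFreeBasis s ↔ IsBasisOf s ⊤ := by
  unfold IsFreeBasis IsBasisOf
  rw [← FreeGroup.range_lift_eq_closure, MonoidHom.range_eq_top]
  rfl

theorem freeBasis_extend {G P X : Type} [Group G] [Group P] {b : X → G} (hb : IsFreeBasis b)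
    (f : X → P) : ∃ φ : G →* P, ∀ x, φ (b x) = f x := by
  let e := MulEquiv.ofBijective (FreeGroup.lift b) hb
  refine ⟨(FreeGroup.lift f).comp e.symm.toMonoidHom, fun x => ?_⟩
  have : e.symm (b x) = FreeGroup.of x := by
    rw [MulEquiv.symm_apply_eq]; exact (FreeGroup.lift_apply_of ..).symm
  simp [this]

theorem exists_cocycle {G P X S : Type} [Group G] [Group P] [MulAction G S] {b : X → G}
    (hb : IsFreeBasis b) (e : S → X → P) :
    ∃ c : G → S → P, (∀ x s, c (b x) s = e s x) ∧
      ∀ g h s, c (g * h) s = c g (h • s) * c h s := by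
  let f : X → Equiv.Perm (S × P) := fun x =>
    { toFun := fun p => (b x • p.1, e p.1 x * p.2)
      invFun := fun p => ((b x)⁻¹ • p.1, (e ((b x)⁻¹ • p.1) x)⁻¹ * p.2)
      left_inv := fun p => by simp
      right_inv := fun p => by simp }
  obtain ⟨φ, hφ⟩ := freeBasis_extend hb f
  have htop : Subgroup.closure (Set.range b) = ⊤ := ((isFreeBasis_iff b).1 hb).2
  have key : ∀ g : G, ∀ s : S, ∀ w : P, φ g (s, w) = (g • s, (φ g (s, 1)).2 * w) := by
    intro g
    have hg : g ∈ Subgroup.closure (Set.range b) := by rw [htop]; trivial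
    induction hg using Subgroup.closure_induction with
    | mem x hx =>
      obtain ⟨x, rfl⟩ := hx
      intro s w
      rw [hφ]
      simp [f]
    | one => intro s w; simp
    | mul x y _ _ hx hy =>
      intro s w
      rw [map_mul, Equiv.Perm.mul_apply, Equiv.Perm.mul_apply, hy s w, hx, hy s 1, hx (y • s) (_ * 1)]
      simp [mul_smul, mul_assoc]
    | inv x _ hx =>
      intro s w
      have h1 : ∀ w : P, (φ x⁻¹) (s, w) = (x⁻¹ • s, (φ x (x⁻¹ • s, 1)).2⁻¹ * w) := by
        intro w
        rw [map_inv, Equiv.Perm.inv_eq_iff_eq, hx]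
        simp
      rw [h1 w, h1 1]
      simp
  refine ⟨fun g s => (φ g (s, 1)).2, ?_, ?_⟩
  · intro x s
    simp [hφ, f]
  · intro g h s
    show (φ (g * h) (s, 1)).2 = _
    rw [map_mul, Equiv.Perm.mul_apply, key h s 1, key g]
    simp

theorem ff_inf_of_basis {G X : Type} [Group G] (b : X → G) (hb : IsFreeBasis b) (Y : Set X)
    (K : Subgroup G) : FF (K ⊓ Subgroup.closure (b '' Y)) K := by
  classical
  have htop : Subgroup.closure (Set.range b) = ⊤ := ((isFreeBasis_iff b).1 hb).2
  obtain ⟨t, ht, ht1, hgood, htA⟩ := sch_exists b htop K Y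
  set A := Subgroup.closure (b '' Y) with hA
  have hstab : ∀ g : G, g • ((1 : G) : G ⧸ K) = (g : G ⧸ K) := fun g => by
    show ((g * 1 : G) : G ⧸ K) = _
    rw [mul_one]
  have ht' : ∀ s, t s • ((1 : G) : G ⧸ K) = s := fun s => by rw [hstab, ht]
  -- the elements
  let q : (G ⧸ K) → X → G := fun s x => (t (b x • s))⁻¹ * b x * t s
  have hmemK : ∀ g : G, g • ((1 : G) : G ⧸ K) = ((1 : G) : G ⧸ K) ↔ g ∈ K := by
    intro g
    rw [hstab, eq_comm, QuotientGroup.eq]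
    simp
  have hqK : ∀ s x, q s x ∈ K := by
    intro s x
    rw [← hmemK]
    simp only [q, mul_smul, ht']
    rw [inv_smul_eq_iff, ht']
  let E : Type := {p : (G ⧸ K) × X // q p.1 p.2 ≠ 1}
  let s₀ : E → G := fun p => q p.1.1 p.1.2
  let e : (G ⧸ K) → X → FreeGroup E := fun s x =>
    if h : q s x ≠ 1 then FreeGroup.of ⟨(s, x), h⟩ else 1
  obtain ⟨c, hcb, hcm⟩ := exists_cocycle (S := G ⧸ K) hb e
  have hc1 : ∀ s, c 1 s = 1 := by
    intro s
    have := hcm 1 1 s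
    simpa using this
  have hcinv : ∀ g s, c g⁻¹ s = (c g (g⁻¹ • s))⁻¹ := by
    intro g s
    have := hcm g g⁻¹ s
    rw [mul_inv_cancel, hc1] at this
    exact (inv_eq_of_mul_eq_one_right this.symm).symm
  have hpsi : ∀ g s, FreeGroup.lift s₀ (c g s) = (t (g • s))⁻¹ * g * t s := by
    intro g
    have hg : g ∈ Subgroup.closure (Set.range b) := by rw [htop]; trivial
    induction hg using Subgroup.closure_induction with
    | mem x hx =>
      obtain ⟨x, rfl⟩ := hx
      intro s
      rw [hcb]
      by_cases h : q s x = 1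
      · simp only [e, h]
        simpa using h.symm
      · have : e s x = FreeGroup.of ⟨(s, x), h⟩ := dif_pos h
        rw [this, FreeGroup.lift_apply_of]
    | one => intro s; simp [hc1]
    | mul x y _ _ hx hy =>
      intro s
      rw [hcm, map_mul, hx, hy, mul_smul]
      group
    | inv x _ hx =>
      intro s
      rw [hcinv, map_inv, hx]
      simp [mul_assoc]
  have hct : ∀ s, c (t s) ((1 : G) : G ⧸ K) = 1 := by
    intro s
    have : ∀ g, SchGood b (Set.range t) g → c g ((1 : G) : G ⧸ K) = 1 := by
      intro g hg
      induction hg with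
      | one => exact hc1 _
      | step x u _ hu hxu ih =>
        obtain ⟨s, rfl⟩ := hu
        obtain ⟨s', hs'⟩ := hxu
        rw [hcm, ih, mul_one, ht', hcb]
        have : s' = b x • s := by rw [← ht' s', hs', mul_smul, ht']
        have hq : q s x = 1 := by
          simp only [q]
          rw [← this, hs']; group
        simp [e, hq]
      | stepInv x u _ hu hxu ih =>
        obtain ⟨s, rfl⟩ := hu
        obtain ⟨s', hs'⟩ := hxu
        rw [hcm, ih, mul_one, ht', hcinv, hcb]
        have : s' = (b x)⁻¹ • s := by rw [← ht' s', hs', mul_smul, ht']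
        have hq : q ((b x)⁻¹ • s) x = 1 := by
          simp only [q]
          rw [← this, hs', this, smul_inv_smul]; group
        simp [e, hq]
    exact this _ (hgood s)
  have hctinv : ∀ s, c (t s)⁻¹ s = 1 := by
    intro s
    rw [hcinv]
    have : (t s)⁻¹ • s = ((1 : G) : G ⧸ K) := by rw [inv_smul_eq_iff, ht']
    rw [this, hct, inv_one]
  have hrangeK : ∀ w : FreeGroup E, FreeGroup.lift s₀ w ∈ K := by
    intro w
    have : (FreeGroup.lift s₀).range ≤ K :=
      FreeGroup.range_lift_le (by rintro _ ⟨p, rfl⟩; exact hqK _ _)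
    exact this ⟨w, rfl⟩
  have hretr : ∀ w : FreeGroup E, c (FreeGroup.lift s₀ w) ((1 : G) : G ⧸ K) = w := by
    intro w
    induction w using FreeGroup.induction_on with
    | C1 => simp [hc1]
    | of p =>
      obtain ⟨⟨s, x⟩, hp⟩ := p
      simp only [FreeGroup.lift_apply_of, s₀, q]
      rw [hcm, hct, hcm, ht', hctinv, hcb]
      simp [e, hp]
    | inv_of p ih =>
      rw [map_inv, hcinv, (hmemK _).2 (K.inv_mem (hrangeK _)), ih]
    | mul x y hx hy =>
      rw [map_mul, hcm, (hmemK _).2 (hrangeK _), hx, hy]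
  refine ⟨E, s₀, {p | p.1.1 ∈ ((fun a : G => (a : G ⧸ K)) '' (A : Set G)) ∧ p.1.2 ∈ Y},
    ⟨?_, ?_⟩, ?_⟩
  · intro w w' h
    rw [← hretr w, ← hretr w', h]
  · rw [← FreeGroup.range_lift_eq_closure]
    apply le_antisymm
    · rintro _ ⟨w, rfl⟩
      exact hrangeK w
    · intro k hk
      refine ⟨c k ((1 : G) : G ⧸ K), ?_⟩
      rw [hpsi, (hmemK _).2 hk, ht1]
      simp
  · have hbA : ∀ y ∈ Y, b y ∈ A := fun y hy => Subgroup.subset_closure ⟨y, hy, rfl⟩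
    apply le_antisymm
    · rw [Subgroup.closure_le]
      rintro _ ⟨⟨⟨s, x⟩, hp⟩, ⟨⟨a, ha, rfl⟩, hx⟩, rfl⟩
      refine ⟨hqK _ _, ?_⟩
      have h1 := htA a ha
      have h2 := htA (b x * a) (A.mul_mem (hbA x hx) ha)
      exact A.mul_mem (A.mul_mem (A.inv_mem h2) (hbA x hx)) h1
    · rintro k ⟨hkK, hkA⟩
      set J : Set E := {p | p.1.1 ∈ ((fun a : G => (a : G ⧸ K)) '' (A : Set G)) ∧ p.1.2 ∈ Y}
      have key : ∀ g ∈ A, ∀ a ∈ A, (t (g • (a : G ⧸ K)))⁻¹ * g * t (a : G ⧸ K) ∈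
          Subgroup.closure (s₀ '' J) := by
        intro g hg
        induction hg using Subgroup.closure_induction with
        | mem x hx =>
          obtain ⟨y, hy, rfl⟩ := hx
          intro a ha
          by_cases h : q (a : G ⧸ K) y = 1
          · show q (a : G ⧸ K) y ∈ _
            rw [h]; exact Subgroup.one_mem _
          · exact Subgroup.subset_closure ⟨⟨((a : G ⧸ K), y), h⟩, ⟨⟨a, ha, rfl⟩, hy⟩, rfl⟩
        | one => intro a ha; simp
        | mul x y hx' hy' hx hy =>
          intro a ha
          have h1 := hx (y * a) (A.mul_mem hy' ha)
          have h2 := hy a ha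
          have h3 := Subgroup.mul_mem _ h1 h2
          have h4 : ((y * a : G) : G ⧸ K) = y • (a : G ⧸ K) := rfl
          rw [h4] at h3
          rw [mul_smul]
          convert h3 using 1
          group
        | inv x hx' hx =>
          intro a ha
          have h1 := Subgroup.inv_mem _ (hx (x⁻¹ * a) (A.mul_mem (A.inv_mem hx') ha))
          have h4 : ((x⁻¹ * a : G) : G ⧸ K) = x⁻¹ • (a : G ⧸ K) := rfl
          rw [h4, smul_inv_smul] at h1
          convert h1 using 1
          group
      have := key k hkA 1 A.one_mem
      rw [(hmemK _).2 hkK, ht1] at this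
      simpa using this

/-! ### Changing bases -/

theorem IsBasisOf.mem_iff {G ι : Type} [Group G] {s : ι → G} {K : Subgroup G}
    (h : IsBasisOf s K) (g : G) : g ∈ K ↔ ∃ w, FreeGroup.lift s w = g := by
  rw [← h.2, ← FreeGroup.range_lift_eq_closure]
  rfl

theorem IsBasisOf.replace {G ι ι' : Type} [Group G] {s₁ : ι' → G} {M : Subgroup G}
    (h' : IsBasisOf s₁ M) (J : Set ι') {s : ι → G}
    (h : IsBasisOf s (Subgroup.closure (s₁ '' J))) :
    IsBasisOf (Sum.elim s (fun j : (Jᶜ : Set ι') => s₁ j)) M := by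
  classical
  have hmem : ∀ j ∈ J, ∃ w, FreeGroup.lift s w = s₁ j := fun j hj =>
    (h.mem_iff _).1 (Subgroup.subset_closure ⟨j, hj, rfl⟩)
  choose! u hu using hmem
  let θ : FreeGroup ι' →* FreeGroup (ι ⊕ (Jᶜ : Set ι')) := FreeGroup.lift fun j =>
    if hj : j ∈ J then FreeGroup.map Sum.inl (u j) else FreeGroup.of (Sum.inr ⟨j, hj⟩)
  have h1 : ∀ g ∈ Subgroup.closure (s₁ '' J), ∃ w v, FreeGroup.lift s₁ w = g ∧
      FreeGroup.lift s v = g ∧ θ w = FreeGroup.map Sum.inl v := by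
    intro g hg
    induction hg using Subgroup.closure_induction with
    | mem x hx =>
      obtain ⟨j, hj, rfl⟩ := hx
      exact ⟨FreeGroup.of j, u j, by simp, hu j hj, by simp [θ, hj]⟩
    | one => exact ⟨1, 1, by simp, by simp, by simp⟩
    | mul x y _ _ hx hy =>
      obtain ⟨w, v, a1, a2, a3⟩ := hx
      obtain ⟨w', v', b1, b2, b3⟩ := hy
      exact ⟨w * w', v * v', by rw [map_mul, a1, b1], by rw [map_mul, a2, b2],
        by rw [map_mul, map_mul, a3, b3]⟩
    | inv x _ hx =>
      obtain ⟨w, v, a1, a2, a3⟩ := hx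
      exact ⟨w⁻¹, v⁻¹, by rw [map_inv, a1], by rw [map_inv, a2], by rw [map_inv, map_inv, a3]⟩
  have h2 : ∀ v : FreeGroup (ι ⊕ (Jᶜ : Set ι')), ∃ w, FreeGroup.lift s₁ w =
      FreeGroup.lift (Sum.elim s (fun j : (Jᶜ : Set ι') => s₁ j)) v ∧ θ w = v := by
    intro v
    induction v using FreeGroup.induction_on with
    | C1 => exact ⟨1, by simp, by simp⟩
    | of p =>
      rcases p with i | ⟨j, hj⟩
      · obtain ⟨w, v, a1, a2, a3⟩ := h1 (s i) (by
          rw [h.mem_iff]; exact ⟨FreeGroup.of i, by simp⟩)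
        have : v = FreeGroup.of i := h.1 (by rw [a2]; simp)
        exact ⟨w, by simp [a1], by rw [a3, this]; simp⟩
      · have hj' : j ∉ J := hj
        exact ⟨FreeGroup.of j, by simp, by simp [θ, hj']⟩
    | inv_of p ih =>
      obtain ⟨w, a1, a2⟩ := ih
      exact ⟨w⁻¹, by rw [map_inv, map_inv, a1], by rw [map_inv, a2]⟩
    | mul x y hx hy =>
      obtain ⟨w, a1, a2⟩ := hx
      obtain ⟨w', b1, b2⟩ := hy
      exact ⟨w * w', by rw [map_mul, map_mul, a1, b1], by rw [map_mul, a2, b2]⟩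
  refine ⟨?_, ?_⟩
  · rw [injective_iff_map_eq_one]
    intro v hv
    obtain ⟨w, a1, a2⟩ := h2 v
    rw [hv] at a1
    have : w = 1 := h'.1 (by rw [a1, map_one])
    rw [← a2, this, map_one]
  · rw [Set.Sum.elim_range, Subgroup.closure_union, h.2, ← h'.2, ← Subgroup.closure_union]
    apply le_antisymm
    · rw [Subgroup.closure_le]
      rintro _ (⟨j, -, rfl⟩ | ⟨j, rfl⟩)
      · exact Subgroup.subset_closure ⟨j, rfl⟩
      · exact Subgroup.subset_closure ⟨_, rfl⟩
    · apply Subgroup.closure_mono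
      rintro _ ⟨j, rfl⟩
      by_cases hj : j ∈ J
      · exact Or.inl ⟨j, hj, rfl⟩
      · exact Or.inr ⟨⟨j, hj⟩, rfl⟩

theorem IsBasisOf.reindex {G ι κ : Type} [Group G] {s : ι → G} {K : Subgroup G}
    (h : IsBasisOf s K) (e : κ ≃ ι) : IsBasisOf (s ∘ e) K := by
  refine ⟨?_, ?_⟩
  · have : ∀ w, FreeGroup.lift (s ∘ e) w = FreeGroup.lift s (FreeGroup.map e w) := by
      intro w
      induction w using FreeGroup.induction_on with
      | C1 => simp
      | of => simp
      | inv_of x ih => simp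
      | mul x y hx hy => simp [hx, hy]
    intro w w' hw
    rw [this, this] at hw
    exact FreeGroup.map_injective e.injective (h.1 hw)
  · rw [Set.range_comp, e.range_eq_univ, Set.image_univ, h.2]

theorem IsBasisOf.restrict {G ι : Type} [Group G] {s : ι → G} {K : Subgroup G}
    (h : IsBasisOf s K) (J : Set ι) :
    IsBasisOf (fun j : J => s j) (Subgroup.closure (s '' J)) := by
  refine ⟨?_, ?_⟩
  · have : ∀ w, FreeGroup.lift (fun j : J => s j) w =
        FreeGroup.lift s (FreeGroup.map Subtype.val w) := by
      intro w
      induction w using FreeGroup.induction_on with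
      | C1 => simp
      | of => simp
      | inv_of x ih => simp
      | mul x y hx hy => simp [hx, hy]
    intro w w' hw
    rw [this, this] at hw
    exact FreeGroup.map_injective Subtype.val_injective (h.1 hw)
  · congr 1
    ext x
    simp

theorem FF.le {G : Type} [Group G] {C K : Subgroup G} (h : FF C K) : C ≤ K := by
  obtain ⟨ι, s, J, hs, rfl⟩ := h
  rw [← hs.2]
  exact Subgroup.closure_mono (Set.image_subset_range _ _)

theorem FF.trans {G : Type} [Group G] {C K M : Subgroup G} (h : FF C K) (h' : FF K M) :
    FF C M := by
  obtain ⟨ι, s, J, hs, rfl⟩ := h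
  obtain ⟨ι', s', J', hs', rfl⟩ := h'
  refine ⟨_, _, Sum.inl '' J, hs'.replace J' hs, ?_⟩
  rw [Set.image_image]
  simp

theorem FF.inf {G : Type} [Group G] {A : Subgroup G} (h : FF A ⊤) (K : Subgroup G) :
    FF (K ⊓ A) K := by
  obtain ⟨ι, s, J, hs, rfl⟩ := h
  exact ff_inf_of_basis s ((isFreeBasis_iff s).2 hs) J K

theorem FF.of_le {G : Type} [Group G] {A K : Subgroup G} (h : FF A ⊤) (hle : A ≤ K) :
    FF A K := by
  have := h.inf K
  rwa [inf_eq_right.2 hle] at this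

/-- subgroups of free groups have bases. -/
theorem exists_basis {G X : Type} [Group G] {b : X → G} (hb : IsFreeBasis b) (K : Subgroup G) :
    ∃ (ι : Type) (s : ι → G), IsBasisOf s K := by
  obtain ⟨ι, s, -, hs, -⟩ := ff_inf_of_basis b hb ∅ K
  exact ⟨ι, s, hs⟩

/-! ### Free factors -/

theorem FF.isFreeFactor {G : Type} [Group G] {A : Subgroup G} (h : FF A ⊤) :
    IsFreeFactor A := by
  classical
  obtain ⟨ι, s, J, hs, hA⟩ := h
  have hfb := (isFreeBasis_iff s).2 hs
  let B := Subgroup.closure (s '' Jᶜ)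
  have hsA : ∀ j ∈ J, s j ∈ A := fun j hj => by
    rw [← hA]; exact Subgroup.subset_closure ⟨j, hj, rfl⟩
  have hsB : ∀ j, j ∉ J → s j ∈ B := fun j hj => Subgroup.subset_closure ⟨j, hj, rfl⟩
  obtain ⟨φ, hφ⟩ := freeBasis_extend (P := Monoid.Coprod A B) hfb (fun j =>
    if hj : j ∈ J then Monoid.Coprod.inl ⟨s j, hsA j hj⟩ else Monoid.Coprod.inr ⟨s j, hsB j hj⟩)
  have hφA : ∀ g (hg : g ∈ A), φ g = Monoid.Coprod.inl ⟨g, hg⟩ := by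
    subst hA
    intro g hg
    induction hg using Subgroup.closure_induction with
    | mem x hx =>
      obtain ⟨j, hj, rfl⟩ := hx
      rw [hφ, dif_pos hj]
    | one => rw [map_one]; exact (map_one _).symm
    | mul x y _ _ hx hy => rw [map_mul, hx, hy, ← map_mul]; rfl
    | inv x _ hx => rw [map_inv, hx, ← map_inv]; rfl
  have hφB : ∀ g (hg : g ∈ B), φ g = Monoid.Coprod.inr ⟨g, hg⟩ := by
    intro g hg
    induction hg using Subgroup.closure_induction with
    | mem x hx =>
      obtain ⟨j, hj, rfl⟩ := hx
      rw [hφ, dif_neg hj]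
    | one => rw [map_one]; exact (map_one _).symm
    | mul x y _ _ hx hy => rw [map_mul, hx, hy, ← map_mul]; rfl
    | inv x _ hx => rw [map_inv, hx, ← map_inv]; rfl
  refine ⟨B, ?_, ?_⟩
  · have hcomp : φ.comp (Monoid.Coprod.lift A.subtype B.subtype) = MonoidHom.id _ := by
      apply Monoid.Coprod.hom_ext
      · ext a
        simp [hφA a a.2]
      · ext a
        simp [hφB a a.2]
    intro x y hxy
    have := DFunLike.congr_fun hcomp
    have hx := this x
    have hy := this y
    simp only [MonoidHom.comp_apply, MonoidHom.id_apply] at hx hy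
    rw [← hx, ← hy, hxy]
  · rw [← MonoidHom.range_eq_top, Monoid.Coprod.range_lift, Subgroup.range_subtype,
      Subgroup.range_subtype, ← hA, ← Subgroup.closure_union, ← Set.image_union,
      Set.union_compl_self, Set.image_univ, hs.2]

theorem IsFreeFactor.ff {G X : Type} [Group G] {b : X → G} (hb : IsFreeBasis b)
    {A : Subgroup G} (h : IsFreeFactor A) : FF A ⊤ := by
  obtain ⟨B, hB⟩ := h
  obtain ⟨ι, s, hs⟩ := exists_basis hb A
  obtain ⟨κ, t, ht⟩ := exists_basis hb B
  let L := MulEquiv.ofBijective _ hB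
  have hsA : ∀ i, s i ∈ A := fun i => by rw [hs.mem_iff]; exact ⟨FreeGroup.of i, by simp⟩
  have htB : ∀ i, t i ∈ B := fun i => by rw [ht.mem_iff]; exact ⟨FreeGroup.of i, by simp⟩
  have hfs : IsFreeBasis (fun i => (⟨s i, hsA i⟩ : A)) := by
    have hval : ∀ w, ((FreeGroup.lift (fun i => (⟨s i, hsA i⟩ : A)) w : A) : G) =
        FreeGroup.lift s w := by
      intro w
      induction w using FreeGroup.induction_on with
      | C1 => simp
      | of => simp
      | inv_of x ih => simp
      | mul x y hx hy => simp [hx, hy]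
    refine ⟨fun x y hxy => hs.1 ?_, fun a => ?_⟩
    · rw [← hval, ← hval, hxy]
    · obtain ⟨w, hw⟩ := (hs.mem_iff a).1 a.2
      exact ⟨w, Subtype.ext (by rw [hval, hw])⟩
  have hft : IsFreeBasis (fun i => (⟨t i, htB i⟩ : B)) := by
    have hval : ∀ w, ((FreeGroup.lift (fun i => (⟨t i, htB i⟩ : B)) w : B) : G) =
        FreeGroup.lift t w := by
      intro w
      induction w using FreeGroup.induction_on with
      | C1 => simp
      | of => simp
      | inv_of x ih => simp
      | mul x y hx hy => simp [hx, hy]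
    refine ⟨fun x y hxy => ht.1 ?_, fun a => ?_⟩
    · rw [← hval, ← hval, hxy]
    · obtain ⟨w, hw⟩ := (ht.mem_iff a).1 a.2
      exact ⟨w, Subtype.ext (by rw [hval, hw])⟩
  obtain ⟨α, hα⟩ := freeBasis_extend hfs (fun i => (FreeGroup.of (Sum.inl i) : FreeGroup (ι ⊕ κ)))
  obtain ⟨β, hβ⟩ := freeBasis_extend hft (fun i => (FreeGroup.of (Sum.inr i) : FreeGroup (ι ⊕ κ)))
  let θ : G →* FreeGroup (ι ⊕ κ) := (Monoid.Coprod.lift α β).comp L.symm.toMonoidHom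
  have hθs : ∀ i, θ (s i) = FreeGroup.of (Sum.inl i) := by
    intro i
    have : L.symm (s i) = Monoid.Coprod.inl ⟨s i, hsA i⟩ := by
      rw [MulEquiv.symm_apply_eq]
      exact (Monoid.Coprod.lift_apply_inl A.subtype B.subtype ⟨s i, hsA i⟩).symm
    simp [θ, this, hα]
  have hθt : ∀ i, θ (t i) = FreeGroup.of (Sum.inr i) := by
    intro i
    have : L.symm (t i) = Monoid.Coprod.inr ⟨t i, htB i⟩ := by
      rw [MulEquiv.symm_apply_eq]
      exact (Monoid.Coprod.lift_apply_inr A.subtype B.subtype ⟨t i, htB i⟩).symm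
    simp [θ, this, hβ]
  refine ⟨ι ⊕ κ, Sum.elim s t, Set.range Sum.inl, ⟨?_, ?_⟩, ?_⟩
  · have : ∀ w, θ (FreeGroup.lift (Sum.elim s t) w) = w := by
      intro w
      induction w using FreeGroup.induction_on with
      | C1 => simp
      | of x => rcases x with i | i <;> simp [hθs, hθt]
      | inv_of x ih => rw [map_inv, map_inv, ih]
      | mul x y hx hy => rw [map_mul, map_mul, hx, hy]
    intro x y hxy
    rw [← this x, ← this y, hxy]
  · rw [Set.Sum.elim_range, Subgroup.closure_union, hs.2, ht.2]
    have := MonoidHom.range_eq_top.2 hB.2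
    rwa [Monoid.Coprod.range_lift, Subgroup.range_subtype, Subgroup.range_subtype] at this
  · rw [← Set.range_comp]
    exact hs.2

/-! ### Ranks -/

theorem IsBasisOf.equiv {G ι : Type} [Group G] {s : ι → G} {K : Subgroup G}
    (h : IsBasisOf s K) : Nonempty (FreeGroup ι ≃* K) := by
  have hr : (FreeGroup.lift s).range = K := by rw [FreeGroup.range_lift_eq_closure, h.2]
  exact ⟨(MonoidHom.ofInjective h.1).trans (MulEquiv.subgroupCongr hr)⟩

theorem IsBasisOf.hasRank {G : Type} [Group G] {r : ℕ} {s : Fin r → G} {K : Subgroup G}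
    (h : IsBasisOf s K) : HasRank K r := h.equiv

theorem HasRank.exists_basis {G : Type} [Group G] {r : ℕ} {K : Subgroup G}
    (h : HasRank K r) : ∃ s : Fin r → G, IsBasisOf s K := by
  obtain ⟨e⟩ := h
  have hs : ∀ w, FreeGroup.lift (fun i => ((e (FreeGroup.of i) : K) : G)) w = (e w : G) := by
    intro w
    induction w using FreeGroup.induction_on with
    | C1 => simp
    | of => simp
    | inv_of x ih => simp
    | mul x y hx hy => simp [hx, hy]
  refine ⟨fun i => ((e (FreeGroup.of i) : K) : G), ?_, ?_⟩
  · intro x y hxy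
    rw [hs, hs] at hxy
    exact e.injective (Subtype.ext hxy)
  · rw [← FreeGroup.range_lift_eq_closure]
    ext g
    constructor
    · rintro ⟨w, rfl⟩
      rw [hs]; exact (e w).2
    · intro hg
      exact ⟨e.symm ⟨g, hg⟩, by rw [hs]; simp⟩

theorem IsBasisOf.index_equiv {G ι : Type} [Group G] {s : ι → G} {K : Subgroup G} {r : ℕ}
    (h : IsBasisOf s K) (hr : HasRank K r) : Nonempty (ι ≃ Fin r) := by
  obtain ⟨e⟩ := h.equiv
  obtain ⟨e'⟩ := hr
  exact ⟨Equiv.ofFreeGroupEquiv (e.trans e'.symm)⟩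

theorem HasRank.unique {G : Type} [Group G] {K : Subgroup G} {r r' : ℕ}
    (h : HasRank K r) (h' : HasRank K r') : r = r' := by
  obtain ⟨s, hs⟩ := h.exists_basis
  obtain ⟨e⟩ := hs.index_equiv h'
  simpa using Fintype.card_congr e

theorem FF.hasRank {G : Type} [Group G] {C K : Subgroup G} {r : ℕ} (h : FF C K)
    (hr : HasRank K r) : ∃ r', HasRank C r' ∧ r' ≤ r ∧ (r' = r → C = K) := by
  classical
  obtain ⟨ι, s, J, hs, rfl⟩ := h
  obtain ⟨e⟩ := hs.index_equiv hr
  have : Finite ι := Finite.of_equiv _ e.symm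
  have := Fintype.ofFinite ι
  have hJ := hs.restrict J
  have hcard : Fintype.card ι = r := by simpa using Fintype.card_congr e
  refine ⟨Fintype.card J, (hJ.reindex (Fintype.equivFin J).symm).hasRank, ?_, ?_⟩
  · rw [← hcard]
    exact Fintype.card_subtype_le _
  · intro h
    have : J = Set.univ := by
      rw [← Set.toFinset_eq_univ (s := J), ← Finset.card_eq_iff_eq_univ, Set.toFinset_card, h, hcard]
    rw [this, Set.image_univ, hs.2]

theorem hasRank_bot {G : Type} [Group G] : HasRank (⊥ : Subgroup G) 0 := by
  have : IsBasisOf (Fin.elim0 : Fin 0 → G) ⊥ := by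
    refine ⟨Function.injective_of_subsingleton _, ?_⟩
    rw [Set.range_eq_empty, Subgroup.closure_empty]
  exact this.hasRank

theorem HasRank.eq_bot {G : Type} [Group G] {H : Subgroup G} (h : HasRank H 0) : H = ⊥ := by
  obtain ⟨s, hs⟩ := h.exists_basis
  rw [← hs.2, Set.range_eq_empty, Subgroup.closure_empty]

/-! ### Supports and prefixes -/

theorem exists_support {G : Type} [Group G] {n : ℕ} {b : Fin n → G} (hb : IsFreeBasis b)
    (H : Subgroup G) : ∃ B, IsFFSupport H B := by
  classical
  have hb' := (isFreeBasis_iff b).1 hb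
  have hex : ∃ k, ∃ B : Subgroup G, FF B ⊤ ∧ H ≤ B ∧ HasRank B k :=
    ⟨n, ⊤, ⟨_, b, Set.univ, hb', by rw [Set.image_univ, hb'.2]⟩, le_top, hb'.hasRank⟩
  obtain ⟨B, hB, hHB, hrk⟩ := Nat.find_spec hex
  refine ⟨B, hB.isFreeFactor, hHB, fun B' hB' hHB' => ?_⟩
  have h1 : FF (B ⊓ B') B := (hB'.ff hb).inf B
  obtain ⟨k, hk, hle, heq⟩ := h1.hasRank hrk
  have h2 : Nat.find hex ≤ k := Nat.find_min' hex ⟨B ⊓ B', h1.trans hB, le_inf hHB hHB', hk⟩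
  exact inf_eq_left.1 (heq (le_antisymm hle h2))

theorem prefix_ff {G : Type} [Group G] {n : ℕ} {b : Fin n → G} {K : Subgroup G}
    (hb : IsBasisOf b K) (i : ℕ) : FF (prefixSubgroup b i) K := ⟨_, b, _, hb, rfl⟩

theorem prefix_mono {G : Type} [Group G] {n : ℕ} (b : Fin n → G) {i j : ℕ} (h : i ≤ j) :
    prefixSubgroup b i ≤ prefixSubgroup b j :=
  Subgroup.closure_mono (Set.image_mono fun _ hx => lt_of_lt_of_le hx h)

theorem prefix_zero {G : Type} [Group G] {n : ℕ} (b : Fin n → G) :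
    prefixSubgroup b 0 = ⊥ := by
  simp [prefixSubgroup]

theorem prefix_top {G : Type} [Group G] {n : ℕ} {b : Fin n → G} {K : Subgroup G}
    (hb : IsBasisOf b K) : prefixSubgroup b n = K := by
  have : {j : Fin n | (j : ℕ) < n} = Set.univ := by ext j; simp
  rw [prefixSubgroup, this, Set.image_univ, hb.2]

theorem basis_extend {G : Type} [Group G] {C D : Subgroup G} (h : FF C D) {d : ℕ}
    (hd : HasRank D d) {k : ℕ} {a : Fin k → G} (ha : IsBasisOf a C) :
    ∃ (l : ℕ) (a' : Fin (k + l) → G), IsBasisOf a' D ∧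
      ∀ i ≤ k, prefixSubgroup a' i = prefixSubgroup a i := by
  obtain ⟨ι, s, J, hs, rfl⟩ := h
  obtain ⟨e⟩ := hs.index_equiv hd
  have : Finite ι := Finite.of_equiv _ e.symm
  obtain ⟨l, ⟨e'⟩⟩ := Finite.exists_equiv_fin (Jᶜ : Set ι)
  have h1 := hs.replace J ha
  let f : Fin (k + l) ≃ Fin k ⊕ (Jᶜ : Set ι) :=
    finSumFinEquiv.symm.trans (Equiv.sumCongr (Equiv.refl _) e'.symm)
  refine ⟨l, _, h1.reindex f, ?_⟩
  have hf : ∀ j : Fin k, f (Fin.castAdd l j) = Sum.inl j := fun j => by simp [f]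
  intro i hi
  unfold prefixSubgroup
  congr 1
  ext g
  constructor
  · rintro ⟨j, hj, rfl⟩
    have hj : (j : ℕ) < i := hj
    obtain ⟨j', rfl⟩ : ∃ j' : Fin k, j = Fin.castAdd l j' := ⟨⟨j, by omega⟩, by ext; simp⟩
    exact ⟨j', hj, by simp [hf]⟩
  · rintro ⟨j, hj, rfl⟩
    exact ⟨Fin.castAdd l j, hj, by simp [hf]⟩

/-- the rank growth condition -/
def Slow {G : Type} [Group G] {k : ℕ} (a : Fin k → G) (H : Subgroup G) : Prop :=
  ∀ i < k, ∃ r r' : ℕ, HasRank (H ⊓ prefixSubgroup a i) r' ∧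
    HasRank (H ⊓ prefixSubgroup a (i + 1)) r ∧ r ≤ r' + 1

theorem isEchelonBasis_iff {G : Type} [Group G] {k : ℕ} (a : Fin k → G) (H : Subgroup G) :
    IsEchelonBasis a H ↔ IsBasisOf a ⊤ ∧ Slow a H := by
  unfold IsEchelonBasis Slow
  rw [isFreeBasis_iff, Fin.forall_iff]

theorem inf_rank_mono {G : Type} [Group G] {C D : Subgroup G} (H : Subgroup G) (hC : FF C ⊤)
    (hle : C ≤ D) {d : ℕ} (hd : HasRank (H ⊓ D) d) : ∃ c, HasRank (H ⊓ C) c ∧ c ≤ d := by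
  have h := hC.inf (H ⊓ D)
  rw [inf_assoc, inf_eq_right.2 hle] at h
  obtain ⟨c, hc, hcd, -⟩ := h.hasRank hd
  exact ⟨c, hc, hcd⟩

theorem slow_step {G : Type} [Group G] {n : ℕ} (hn : HasRank (⊤ : Subgroup G) n)
    {C D H : Subgroup G} (hC : FF C ⊤) (hD : FF D ⊤) (hle : C ≤ D) {c d : ℕ}
    (hc : HasRank (H ⊓ C) c) (hd : HasRank (H ⊓ D) d) (hcd : d ≤ c + 1)
    (h : ∃ (k : ℕ) (a : Fin k → G), IsBasisOf a C ∧ Slow a H) :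
    ∃ (k : ℕ) (a : Fin k → G), IsBasisOf a D ∧ Slow a H := by
  obtain ⟨k, a, ha, hs⟩ := h
  obtain ⟨δ, hδ, -⟩ := hD.hasRank hn
  obtain ⟨l, a', ha', hp⟩ := basis_extend (hC.of_le hle) hδ ha
  refine ⟨k + l, a', ha', ?_⟩
  intro i hi
  by_cases hik : i < k
  · rw [hp i hik.le, hp (i + 1) hik]
    exact hs i hik
  · push Not at hik
    have hffi : ∀ i, FF (prefixSubgroup a' i) ⊤ := fun i => (prefix_ff ha' i).trans hD
    obtain ⟨r, hr, hrd⟩ := inf_rank_mono H (hffi (i + 1)) (prefix_ff ha' (i + 1)).le hd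
    obtain ⟨r', hr', -⟩ := inf_rank_mono H (hffi i) (prefix_ff ha' i).le hd
    have hCle : C ≤ prefixSubgroup a' i := by
      rw [← prefix_top ha, ← hp k le_rfl]
      exact prefix_mono a' hik
    obtain ⟨c', hc', hcr⟩ := inf_rank_mono H hC hCle hr'
    have := hc.unique hc'
    exact ⟨r, r', hr', hr, by omega⟩

theorem statement11 {n r : ℕ} (H : Subgroup (FreeGroup (Fin n))) (hH : H.FG)
    (hne : H ≠ ⊥) (hr : HasRank H r) :
    IsEchelon H ↔ ∃ A : Subgroup (FreeGroup (Fin n)), IsFreeFactor A ∧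
      (∃ B : Subgroup (FreeGroup (Fin n)), IsFFSupport H B ∧ A ≤ B) ∧
      HasRank (H ⊓ A) (r - 1) ∧ IsEchelon (H ⊓ A) := by
  have hb₀ : IsFreeBasis (FreeGroup.of : Fin n → FreeGroup (Fin n)) := by
    unfold IsFreeBasis
    rw [FreeGroup.lift_of_eq_id]
    exact Function.bijective_id
  have hn : HasRank (⊤ : Subgroup (FreeGroup (Fin n))) n := ((isFreeBasis_iff _).1 hb₀).hasRank
  constructor
  · rintro ⟨m, b, hb⟩
    obtain ⟨hbas, hslow⟩ := (isEchelonBasis_iff b H).1 hb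
    obtain ⟨B, hB⟩ := exists_support hb₀ H
    have hP : ∀ i, FF (prefixSubgroup b i) ⊤ := prefix_ff hbas
    have hrk : ∀ i, ∃ c, HasRank (H ⊓ prefixSubgroup b i) c := fun i => by
      obtain ⟨c, hc, -⟩ := ((hP i).inf H).hasRank hr
      exact ⟨c, hc⟩
    choose ρ hρ using hrk
    have hρ0 : ρ 0 = 0 := by
      have := hρ 0
      rw [prefix_zero, inf_bot_eq] at this
      exact this.unique hasRank_bot
    have hρm : ρ m = r := by
      have := hρ m
      rw [prefix_top hbas, inf_top_eq] at this
      exact this.unique hr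
    have hstep : ∀ i < m, ρ (i + 1) ≤ ρ i + 1 := by
      intro i hi
      obtain ⟨x, y, hy, hx, hxy⟩ := hslow i hi
      rw [(hρ i).unique hy, (hρ (i + 1)).unique hx]
      exact hxy
    have hr0 : r ≠ 0 := by
      rintro rfl
      exact hne hr.eq_bot
    obtain ⟨i, him, hi⟩ : ∃ i ≤ m, ρ i = r - 1 := by
      have hex : ∃ i, r ≤ ρ i := ⟨m, hρm.ge⟩
      have hspec := Nat.find_spec hex
      have hmin : Nat.find hex ≤ m := Nat.find_min' hex hρm.ge
      obtain ⟨j, hj⟩ : ∃ j, Nat.find hex = j + 1 := by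
        apply Nat.exists_eq_succ_of_ne_zero
        intro h0
        rw [h0, hρ0] at hspec
        omega
      have hlt : ¬ r ≤ ρ j := Nat.find_min hex (by omega)
      rw [hj] at hspec
      have := hstep j (by omega)
      exact ⟨j, by omega, by omega⟩
    have hHA : H ⊓ (B ⊓ prefixSubgroup b i) = H ⊓ prefixSubgroup b i := by
      rw [← inf_assoc, inf_eq_left.2 hB.2.1]
    refine ⟨B ⊓ prefixSubgroup b i, (((hP i).inf B).trans (hB.1.ff hb₀)).isFreeFactor,
      ⟨B, hB, inf_le_left⟩, ?_, ?_⟩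
    · rw [hHA, ← hi]
      exact hρ i
    · rw [hHA]
      refine ⟨m, b, (isEchelonBasis_iff _ _).2 ⟨hbas, ?_⟩⟩
      intro j hj
      rw [inf_assoc, inf_assoc]
      by_cases hji : j < i
      · rw [inf_eq_right.2 (prefix_mono b hji.le),
          inf_eq_right.2 (prefix_mono b (Nat.succ_le_of_lt hji))]
        exact hslow j hj
      · rw [inf_eq_left.2 (prefix_mono b (by omega)), inf_eq_left.2 (prefix_mono b (by omega))]
        exact ⟨_, _, hρ i, hρ i, by omega⟩
  · rintro ⟨A, hA, -, hrA, m, b, hb⟩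
    obtain ⟨hbas, hslow⟩ := (isEchelonBasis_iff b _).1 hb
    have hAff := hA.ff hb₀
    have hP : ∀ i, FF (A ⊓ prefixSubgroup b i) ⊤ := fun i =>
      ((prefix_ff hbas i).inf A).trans hAff
    have hchain : ∀ i ≤ m, ∃ (k : ℕ) (a : Fin k → FreeGroup (Fin n)),
        IsBasisOf a (A ⊓ prefixSubgroup b i) ∧ Slow a H := by
      intro i
      induction i with
      | zero =>
        intro _
        rw [prefix_zero, inf_bot_eq]
        obtain ⟨a, ha⟩ := (hasRank_bot (G := FreeGroup (Fin n))).exists_basis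
        exact ⟨0, a, ha, fun i hi => absurd hi (Nat.not_lt_zero i)⟩
      | succ i ih =>
        intro hi
        obtain ⟨x, y, hy, hx, hxy⟩ := hslow i (by omega)
        rw [inf_assoc] at hx hy
        exact slow_step hn (hP i) (hP (i + 1))
          (inf_le_inf_left _ (prefix_mono b (Nat.le_succ i))) hy hx hxy (ih (by omega))
    have hlast := hchain m le_rfl
    rw [prefix_top hbas, inf_top_eq] at hlast
    have hT : FF (⊤ : Subgroup (FreeGroup (Fin n))) ⊤ :=
      ⟨_, b, Set.univ, hbas, by rw [Set.image_univ, hbas.2]⟩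
    obtain ⟨k, a, ha, hs⟩ := slow_step hn hAff hT le_top hrA
      (by rw [inf_top_eq]; exact hr) (by omega) hlast
    exact ⟨k, a, (isEchelonBasis_iff a H).2 ⟨ha, hs⟩⟩
end

section
/- Let F_3 = ⟨a,b,c⟩, w = c²a²b²a²b²c², H = ⟨a, b, w⟩ and K = ⟨wa⁻¹, awb⟩. Then K is a free factor of H (hence K is echelon in H) and H is echelon in F_3, but K is not echelon in F_3. In particular, the property of being an echelon subgroup is not transitive. -/
noncomputable def a : FreeGroup (Fin 3) := FreeGroup.of 0

noncomputable def b : FreeGroup (Fin 3) := FreeGroup.of 1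

noncomputable def c : FreeGroup (Fin 3) := FreeGroup.of 2

noncomputable def w : FreeGroup (Fin 3) := c ^ 2 * a ^ 2 * b ^ 2 * a ^ 2 * b ^ 2 * c ^ 2

noncomputable def H : Subgroup (FreeGroup (Fin 3)) := Subgroup.closure {a, b, w}

noncomputable def K : Subgroup (FreeGroup (Fin 3)) := Subgroup.closure {w * a⁻¹, a * w * b}

namespace Ech

open FreeGroup

/-- Last-letter colouring. -/
def chi0 (m : ℕ) (x : FreeGroup (Fin (m+1))) : Prop :=
  x.toWord.getLast? = some (Fin.last m, true)

lemma toWord_of_mul {α : Type} [DecidableEq α] (i : α) (x : FreeGroup α) :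
    (FreeGroup.of i * x).toWord = FreeGroup.reduce ((i, true) :: x.toWord) := by
  rw [FreeGroup.toWord_mul, FreeGroup.toWord_of]; rfl

lemma chi0_of_ne (m : ℕ) (i : Fin (m+1)) (hi : i ≠ Fin.last m) (x : FreeGroup (Fin (m+1))) :
    chi0 m (FreeGroup.of i * x) ↔ chi0 m x := by
  unfold chi0
  rw [toWord_of_mul, FreeGroup.reduce.cons, FreeGroup.reduce_toWord]
  rcases x.toWord with _ | ⟨hd, tl⟩
  · simp [hi]
  · dsimp only
    split_ifs with h
    · rcases tl with _ | ⟨h2, tl⟩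
      · simp only [List.getLast?_nil, List.getLast?_singleton, Option.some.injEq]
        constructor
        · intro h; cases h
        · intro h'; rw [h'] at h; exact absurd h.1 hi
      · simp [List.getLast?_cons_cons]
    · simp [List.getLast?_cons_cons]

lemma chi0_of_last (m : ℕ) (x : FreeGroup (Fin (m+1))) (hx : x ≠ 1) :
    chi0 m (FreeGroup.of (Fin.last m) * x) ↔ chi0 m x := by
  have hx' : x.toWord ≠ [] := fun h => hx (FreeGroup.toWord_eq_nil_iff.1 h)
  unfold chi0
  rw [toWord_of_mul, FreeGroup.reduce.cons, FreeGroup.reduce_toWord]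
  rcases hw : x.toWord with _ | ⟨hd, tl⟩
  · exact absurd hw hx'
  · dsimp only
    split_ifs with h
    · rcases tl with _ | ⟨h2, tl⟩
      · simp only [List.getLast?_nil, List.getLast?_singleton, Option.some.injEq]
        constructor
        · intro h; cases h
        · intro h'; rw [h'] at h; simpa using h.2
      · simp [List.getLast?_cons_cons]
    · simp [List.getLast?_cons_cons]

/-- a subset of `G`, as a predicate, with finite coboundary -/
def AlmInv {G : Type} [Group G] (χ : G → Prop) : Prop :=
  ∀ g : G, {x | ¬ (χ (g * x) ↔ χ x)}.Finite

lemma almInv_chi0 (m : ℕ) : AlmInv (chi0 m) := by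
  intro g
  induction g using FreeGroup.induction_on with
  | C1 => simp
  | of i =>
    refine (Set.finite_singleton (1 : FreeGroup (Fin (m+1)))).subset ?_
    intro x hx
    by_contra h
    apply hx
    by_cases hi : i = Fin.last m
    · subst hi; exact chi0_of_last m x h
    · exact chi0_of_ne m i hi x
  | inv_of i ih =>
    refine (ih.image (fun x => FreeGroup.of i * x)).subset ?_
    intro x hx
    refine ⟨(FreeGroup.of i)⁻¹ * x, ?_, by simp⟩
    simp only [Set.mem_ofPred_eq, mul_inv_cancel_left] at hx ⊢
    tauto
  | mul g h hg hh =>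
    refine (hh.union (hg.preimage (f := fun x => h * x) (mul_right_injective h).injOn)).subset ?_
    intro x hx
    simp only [Set.mem_ofPred_eq, Set.mem_union, Set.mem_preimage, mul_assoc] at hx ⊢
    tauto

lemma color_exists {G : Type} [Group G] (m : ℕ) (b : Fin (m+1) → G) (hb : IsFreeBasis b) :
    ∃ χ : G → Prop, AlmInv χ ∧ (∀ g ∈ prefixSubgroup b m, ∀ x, χ (g * x) ↔ χ x) ∧
      (∀ S : Set G, S.Finite → ∃ x ∉ S, χ x) ∧ (∀ S : Set G, S.Finite → ∃ x ∉ S, ¬ χ x) := by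
  let e : FreeGroup (Fin (m+1)) ≃* G := MulEquiv.ofBijective (FreeGroup.lift b) hb
  have he : ∀ i, e.symm (b i) = FreeGroup.of i := by
    intro i
    rw [MulEquiv.symm_apply_eq]
    exact (FreeGroup.lift_apply_of (f := b)).symm
  refine ⟨fun x => chi0 m (e.symm x), ?_, ?_, ?_, ?_⟩
  · intro g
    have := (almInv_chi0 m (e.symm g)).preimage (f := e.symm) e.symm.injective.injOn
    refine this.subset ?_
    intro x hx
    simpa using hx
  · intro g hg
    induction hg using Subgroup.closure_induction with
    | mem g hg =>
      obtain ⟨j, hj, rfl⟩ := hg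
      intro x
      beta_reduce
      rw [_root_.map_mul, he]
      apply chi0_of_ne
      rintro rfl
      simp at hj
    | one => simp
    | mul g h _ _ hg hh => intro x; rw [mul_assoc, hg, hh]
    | inv g _ hg => intro x; rw [← hg, mul_inv_cancel_left]
  · intro S hS
    have hinj : Function.Injective (fun n : ℕ => e ((FreeGroup.of (Fin.last m)) ^ (n+1))) := by
      intro n k h
      have := congrArg FreeGroup.norm (e.injective h)
      simpa using this
    obtain ⟨n, hn⟩ := (Set.infinite_range_of_injective hinj).exists_notMem_finite hS
    obtain ⟨⟨n, rfl⟩, hn⟩ := hn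
    refine ⟨_, hn, ?_⟩
    simp only [chi0]
    rw [MulEquiv.symm_apply_apply, FreeGroup.toWord_of_pow]
    simp [List.getLast?_replicate]
  · intro S hS
    have hinj : Function.Injective (fun n : ℕ => e (((FreeGroup.of (Fin.last m)) ^ (n+1))⁻¹)) := by
      intro n k h
      have := congrArg FreeGroup.norm (inv_injective (e.injective h))
      simpa using this
    obtain ⟨n, hn⟩ := (Set.infinite_range_of_injective hinj).exists_notMem_finite hS
    obtain ⟨⟨n, rfl⟩, hn⟩ := hn
    refine ⟨_, hn, ?_⟩
    simp only [chi0]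
    rw [MulEquiv.symm_apply_apply, FreeGroup.toWord_inv, FreeGroup.toWord_of_pow]
    simp [FreeGroup.invRev, List.getLast?_replicate]

lemma red_sub {α : Type} {L L' : List (α × Bool)} (h : FreeGroup.IsReduced L)
    (hs : ∃ s t, s ++ L' ++ t = L) : FreeGroup.IsReduced L' := by
  obtain ⟨s, t, rfl⟩ := hs
  exact (List.isChain_append.1 (List.isChain_append.1 h).1).2.1

lemma finite_bound {α : Type} [DecidableEq α] {S : Set (FreeGroup α)} (hS : S.Finite) :
    ∃ M : ℕ, ∀ x ∈ S, x.norm < M := by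
  obtain ⟨M, hM⟩ := (hS.image FreeGroup.norm).bddAbove
  exact ⟨M+1, fun x hx => Nat.lt_succ_of_le (hM ⟨x, hx, rfl⟩)⟩

lemma norm_mk_of_red {α : Type} [DecidableEq α] {L : List (α × Bool)} (h : IsReduced L) :
    (FreeGroup.mk L).norm = L.length := by
  rw [FreeGroup.norm, FreeGroup.toWord_mk, h.reduce_eq]

lemma red_pow {α : Type} {q : List (α × Bool)} (hq : IsReduced (q ++ q)) (n : ℕ) :
    IsReduced ((List.replicate (n+1) q).flatten ++ q) := by
  by_cases h0 : q = []
  · subst h0; simp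
  induction n with
  | zero => simpa using hq
  | succ n ih =>
    rw [List.replicate_succ', List.flatten_append]
    have := ih.append_overlap hq h0
    simpa using this

lemma mk_flatten {α : Type} (q : List (α × Bool)) (n : ℕ) :
    FreeGroup.mk (List.replicate n q).flatten = (FreeGroup.mk q) ^ n := by
  induction n with
  | zero => simp [FreeGroup.one_eq_mk]
  | succ n ih => rw [List.replicate_succ, List.flatten_cons, ← FreeGroup.mul_mk, ih, pow_succ']

lemma ray {α : Type} [DecidableEq α] (χ : FreeGroup α → Prop) (hχ : AlmInv χ)
    (A : Subgroup (FreeGroup α)) (hA : ∀ g ∈ A, ∀ x, χ (g * x) ↔ χ x)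
    (q q1 : List (α × Bool)) (s : α × Bool) (hq1 : q = q1 ++ [s]) (hq : IsReduced (q ++ q))
    (h : FreeGroup α) (hh : h * FreeGroup.mk q * h⁻¹ ∈ A) (N : ℕ) (x : List (α × Bool))
    (hx : IsReduced (s :: x)) :
    ∃ y, IsReduced (y ++ s :: x) ∧ N ≤ y.length ∧
      (χ (FreeGroup.mk (y ++ s :: x)) ↔ χ (h * FreeGroup.mk x)) := by
  obtain ⟨M, hM⟩ := finite_bound (hχ h)
  have hlen : ∀ n, n ≤ ((List.replicate n q).flatten).length := by
    intro n
    rw [List.length_flatten, List.map_replicate, List.sum_replicate, hq1]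
    simp only [List.length_append, List.length_singleton, smul_eq_mul]
    exact Nat.le_mul_of_pos_right n (Nat.succ_pos _)
  obtain ⟨n, hn⟩ : ∃ n, n = N + M := ⟨_, rfl⟩
  have e : (List.replicate (n+1) q).flatten ++ q1 ++ s :: x
      = (List.replicate (n+2) q).flatten ++ x := by
    rw [List.replicate_succ' (n := n+1), List.flatten_append]
    simp [hq1]
  have hred : IsReduced ((List.replicate (n+1) q).flatten ++ q1 ++ s :: x) := by
    have h1 := red_pow hq n
    rw [hq1, ← List.append_assoc] at h1
    have := h1.append_overlap (L₃ := x) hx (by simp)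
    rw [hq1]
    simpa using this
  refine ⟨(List.replicate (n+1) q).flatten ++ q1, hred, ?_, ?_⟩
  · have := hlen (n+1)
    rw [List.length_append]; omega
  · have hb : FreeGroup.mk ((List.replicate (n+1) q).flatten ++ q1 ++ s :: x) ∉
        {x | ¬ (χ (h * x) ↔ χ x)} := by
      intro hmem
      have h1 := hM _ hmem
      rw [norm_mk_of_red hred] at h1
      have := hlen (n+1)
      simp only [List.length_append] at h1
      omega
    simp only [Set.mem_ofPred_eq, not_not] at hb
    rw [← hb, e, ← FreeGroup.mul_mk, mk_flatten]
    have : h * (FreeGroup.mk q ^ (n+2) * FreeGroup.mk x) =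
        (h * FreeGroup.mk q * h⁻¹) ^ (n+2) * (h * FreeGroup.mk x) := by
      rw [conj_pow]; group
    rw [this]
    exact hA _ (A.pow_mem hh _) _

lemma red_invRev {α : Type} [DecidableEq α] {q : List (α × Bool)} (h : IsReduced q) :
    IsReduced (FreeGroup.invRev q) := by
  rw [isReduced_iff_reduce_eq, FreeGroup.reduce_invRev, h.reduce_eq]

/-- inverse letter -/
def il {α : Type} (s : α × Bool) : α × Bool := (s.1, !s.2)

/-- The turn between directions `s`, `s'` is taken by an axis of a conjugate of `A`. -/
def Turn {α : Type} (A : Subgroup (FreeGroup α)) (s s' : α × Bool) : Prop :=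
  ∃ (q q1 q2 : List (α × Bool)) (h : FreeGroup α), q = q1 ++ [s] ∧ q = il s' :: q2 ∧
    IsReduced (q ++ q) ∧ h * FreeGroup.mk q * h⁻¹ ∈ A

lemma turn_rays {α : Type} [DecidableEq α] (χ : FreeGroup α → Prop) (hχ : AlmInv χ)
    (A : Subgroup (FreeGroup α)) (hA : ∀ g ∈ A, ∀ x, χ (g * x) ↔ χ x)
    (s s' : α × Bool) (ht : Turn A s s') (N : ℕ) (x : List (α × Bool))
    (hx : IsReduced (s :: x)) (hx' : IsReduced (s' :: x)) :
    ∃ y y', IsReduced (y ++ s :: x) ∧ N ≤ y.length ∧ IsReduced (y' ++ s' :: x) ∧ N ≤ y'.length ∧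
      (χ (FreeGroup.mk (y ++ s :: x)) ↔ χ (FreeGroup.mk (y' ++ s' :: x))) := by
  obtain ⟨q, q1, q2, h, h1, h2, hq, hh⟩ := ht
  obtain ⟨y, hy1, hy2, hy3⟩ := ray χ hχ A hA q q1 s h1 hq h hh N x hx
  have hinv : FreeGroup.invRev q = FreeGroup.invRev q2 ++ [s'] := by
    rw [h2]; simp [FreeGroup.invRev, il]
  have hqi : IsReduced (FreeGroup.invRev q ++ FreeGroup.invRev q) := by
    have := red_invRev hq
    simpa [FreeGroup.invRev] using this
  have hhi : h * FreeGroup.mk (FreeGroup.invRev q) * h⁻¹ ∈ A := by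
    have := A.inv_mem hh
    rw [← FreeGroup.inv_mk]
    simpa [mul_assoc] using this
  obtain ⟨y', hy1', hy2', hy3'⟩ := ray χ hχ A hA _ _ s' hinv hqi h hhi N x hx'
  exact ⟨y, y', hy1, hy2, hy1', hy2', hy3.trans hy3'.symm⟩

def Mono {α : Type} (χ : FreeGroup α → Prop) (N : ℕ) (x : List (α × Bool)) : Prop :=
  ∃ p : Prop, ∀ y, IsReduced (y ++ x) → N ≤ (y ++ x).length → (χ (FreeGroup.mk (y ++ x)) ↔ p)

lemma hex6 (p1 p2 p3 p4 p5 p6 o1 o2 o3 o4 o5 o6 : Prop)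
    (h1 : o1 → o2 → (p1 ↔ p2)) (h2 : o2 → o3 → (p2 ↔ p3)) (h3 : o3 → o4 → (p3 ↔ p4))
    (h4 : o4 → o5 → (p4 ↔ p5)) (h5 : o5 → o6 → (p5 ↔ p6)) (h6 : o6 → o1 → (p6 ↔ p1))
    (k1 : ¬ o1 → o2 ∧ o3 ∧ o4 ∧ o5 ∧ o6) (k2 : ¬ o2 → o3 ∧ o4 ∧ o5 ∧ o6)
    (k3 : ¬ o3 → o4 ∧ o5 ∧ o6) (k4 : ¬ o4 → o5 ∧ o6) (k5 : ¬ o5 → o6) :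
    ∃ P : Prop, (o1 → (p1 ↔ P)) ∧ (o2 → (p2 ↔ P)) ∧ (o3 → (p3 ↔ P)) ∧ (o4 → (p4 ↔ P)) ∧
      (o5 → (p5 ↔ P)) ∧ (o6 → (p6 ↔ P)) := by
  by_cases x1 : o1
  · refine ⟨p1, ?_⟩
    by_cases x2 : o2 <;> by_cases x3 : o3 <;> by_cases x4 : o4 <;> by_cases x5 : o5 <;>
      by_cases x6 : o6 <;> grind
  · refine ⟨p2, ?_⟩
    grind

lemma hexagon (p ok : Fin 3 × Bool → Prop) (hok : ∀ s s', ¬ ok s → ¬ ok s' → s = s')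
    (h1 : ok (2,true) → ok (2,false) → (p (2,true) ↔ p (2,false)))
    (h2 : ok (2,false) → ok (1,true) → (p (2,false) ↔ p (1,true)))
    (h3 : ok (1,true) → ok (1,false) → (p (1,true) ↔ p (1,false)))
    (h4 : ok (1,false) → ok (0,true) → (p (1,false) ↔ p (0,true)))
    (h5 : ok (0,true) → ok (0,false) → (p (0,true) ↔ p (0,false)))
    (h6 : ok (0,false) → ok (2,true) → (p (0,false) ↔ p (2,true))) :
    ∃ P : Prop, ∀ s, ok s → (p s ↔ P) := by
  have nn : ∀ {s s'}, ¬ ok s → s ≠ s' → ok s' := by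
    intro s s' h1 h2
    by_contra h3
    exact h2 (hok _ _ h1 h3)
  obtain ⟨P, g1, g2, g3, g4, g5, g6⟩ := hex6 _ _ _ _ _ _ _ _ _ _ _ _ h1 h2 h3 h4 h5 h6
    (fun h => ⟨nn h (by decide), nn h (by decide), nn h (by decide), nn h (by decide),
      nn h (by decide)⟩)
    (fun h => ⟨nn h (by decide), nn h (by decide), nn h (by decide), nn h (by decide)⟩)
    (fun h => ⟨nn h (by decide), nn h (by decide), nn h (by decide)⟩)
    (fun h => ⟨nn h (by decide), nn h (by decide)⟩)
    (fun h => nn h (by decide))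
  refine ⟨P, ?_⟩
  rintro ⟨j, e⟩
  fin_cases j <;> cases e <;> assumption

theorem whitehead (χ : FreeGroup (Fin 3) → Prop) (hχ : AlmInv χ)
    (A : Subgroup (FreeGroup (Fin 3))) (hA : ∀ g ∈ A, ∀ x, χ (g * x) ↔ χ x)
    (hT : ∀ S : Set (FreeGroup (Fin 3)), S.Finite → ∃ x ∉ S, χ x)
    (hF : ∀ S : Set (FreeGroup (Fin 3)), S.Finite → ∃ x ∉ S, ¬ χ x)
    (h1 : Turn A (2,true) (2,false))
    (h2 : Turn A (1,true) (2,false))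
    (h3 : Turn A (1,true) (1,false))
    (h4 : Turn A (0,true) (1,false))
    (h5 : Turn A (0,true) (0,false))
    (h6 : Turn A (2,true) (0,false)) : False := by
  have hN : ∃ N : ℕ, ∀ s : Fin 3 × Bool, ∀ x : FreeGroup (Fin 3), N ≤ x.norm →
      (χ (FreeGroup.mk [s] * x) ↔ χ x) := by
    choose M hM using fun s : Fin 3 × Bool => finite_bound (hχ (FreeGroup.mk [s]))
    refine ⟨∑ s, M s, fun s x hx => ?_⟩
    by_contra h
    have h1 := hM s x h
    have h2 : M s ≤ ∑ s, M s := Finset.single_le_sum (fun _ _ => Nat.zero_le _) (Finset.mem_univ s)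
    omega
  obtain ⟨N, hN⟩ := hN
  have base : ∀ x : List (Fin 3 × Bool), N ≤ x.length → Mono χ N x := by
    intro x hx
    refine ⟨χ (FreeGroup.mk x), fun y => ?_⟩
    induction y with
    | nil => intros; rfl
    | cons s y ih =>
      intro hr hl
      have hr' : IsReduced (y ++ x) := red_sub hr ⟨[s], [], by simp⟩
      have hl' : N ≤ (y ++ x).length := by rw [List.length_append]; omega
      rw [← ih hr' hl', ← hN s (FreeGroup.mk (y ++ x)) (by rwa [norm_mk_of_red hr']),
        FreeGroup.mul_mk]
      rfl
  have main : ∀ k, ∀ x : List (Fin 3 × Bool), IsReduced x → N ≤ x.length + k → Mono χ N x := by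
    intro k
    induction k with
    | zero => intro x _ hx; exact base x hx
    | succ k ih =>
      intro x hxr hx
      by_cases hxN : N ≤ x.length
      · exact base x hxN
      have hch : ∀ s : Fin 3 × Bool, ∃ p : Prop, IsReduced (s :: x) → ∀ y, IsReduced (y ++ s :: x) →
          N ≤ (y ++ s :: x).length → (χ (FreeGroup.mk (y ++ s :: x)) ↔ p) := by
        intro s
        by_cases hs : IsReduced (s :: x)
        · obtain ⟨p, hp⟩ := ih (s :: x) hs (by simp; omega)
          exact ⟨p, fun _ => hp⟩
        · exact ⟨True, fun h => absurd h hs⟩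
      choose p hp using hch
      have tr : ∀ s s', Turn A s s' → IsReduced (s :: x) → IsReduced (s' :: x) → (p s ↔ p s') := by
        intro s s' ht hs hs'
        obtain ⟨y, y', e1, e2, e3, e4, e5⟩ := turn_rays χ hχ A hA s s' ht N x hs hs'
        rw [← hp s hs y e1 (by rw [List.length_append]; omega),
          ← hp s' hs' y' e3 (by rw [List.length_append]; omega), e5]
      obtain ⟨P, hP⟩ := hexagon p (fun s => IsReduced (s :: x)) (by
        intro s s' hs hs'
        rcases x with _ | ⟨f, x⟩
        · simp at hs
        · simp only [isReduced_cons_cons, hxr, and_true, Classical.not_imp] at hs hs'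
          obtain ⟨i, e⟩ := s
          obtain ⟨i', e'⟩ := s'
          obtain ⟨j, e''⟩ := f
          simp only at hs hs'
          obtain ⟨rfl, hs⟩ := hs
          obtain ⟨rfl, hs'⟩ := hs'
          revert hs hs'
          cases e <;> cases e' <;> cases e'' <;> simp)
        (tr _ _ h1) (fun u v => (tr _ _ h2 v u).symm) (tr _ _ h3) (fun u v => (tr _ _ h4 v u).symm)
        (tr _ _ h5) (fun u v => (tr _ _ h6 v u).symm)
      refine ⟨P, fun y hy hl => ?_⟩
      rcases List.eq_nil_or_concat y with rfl | ⟨y, s, rfl⟩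
      · simp at hl; omega
      · have e : y.concat s ++ x = y ++ s :: x := by simp
        rw [e] at hy hl ⊢
        have hs : IsReduced (s :: x) := red_sub hy ⟨y, [], by simp⟩
        rw [hp s hs y hy hl, hP s hs]
  obtain ⟨P, hP⟩ := main N [] IsReduced.nil (by simp)
  have hfin : {x : FreeGroup (Fin 3) | x.norm < N}.Finite := by
    have := (List.finite_length_lt (Fin 3 × Bool) N).preimage
      (f := FreeGroup.toWord) FreeGroup.toWord_injective.injOn
    exact this
  have all : ∀ x : FreeGroup (Fin 3), ¬ x.norm < N → (χ x ↔ P) := by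
    intro x hx
    have := hP x.toWord (by simpa using isReduced_toWord) (by
      rw [List.append_nil]; exact not_lt.1 hx)
    rwa [List.append_nil, FreeGroup.mk_toWord] at this
  obtain ⟨x, hx, hxT⟩ := hT _ hfin
  obtain ⟨y, hy, hyF⟩ := hF _ hfin
  exact hyF ((all y hy).2 ((all x hx).1 hxT))

lemma turn_symm {α : Type} [DecidableEq α] {A : Subgroup (FreeGroup α)} {s s' : α × Bool}
    (ht : Turn A s s') : Turn A s' s := by
  obtain ⟨q, q1, q2, h, h1, h2, hq, hh⟩ := ht
  refine ⟨FreeGroup.invRev q, FreeGroup.invRev q2, FreeGroup.invRev q1, h, ?_, ?_, ?_, ?_⟩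
  · rw [h2]; simp [FreeGroup.invRev, il]
  · rw [h1]; simp [FreeGroup.invRev, il]
  · have := red_invRev hq
    simpa [FreeGroup.invRev] using this
  · have := A.inv_mem hh
    rw [← FreeGroup.inv_mk]
    simpa [mul_assoc] using this

lemma turn_of_axis {α : Type} {A : Subgroup (FreeGroup α)} (l1 l2 y : List (α × Bool))
    (s t : α × Bool) (p : List (α × Bool)) (hp : p = l1 ++ [s] ++ (t :: l2) ++ y)
    (hr : IsReduced (p ++ p)) (h : FreeGroup α) (hh : h * FreeGroup.mk p * h⁻¹ ∈ A) :
    Turn A s (il t) := by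
  have h0 : p ≠ [] := by rw [hp]; simp
  refine ⟨(t :: l2) ++ y ++ (l1 ++ [s]), (t :: l2) ++ y ++ l1, l2 ++ y ++ (l1 ++ [s]),
    h * FreeGroup.mk (l1 ++ [s]), by simp, by simp [il], ?_, ?_⟩
  · have h3 := hr.append_overlap hr h0
    refine red_sub h3 ⟨l1 ++ [s], (t :: l2) ++ y, ?_⟩
    rw [hp]; simp
  · convert hh using 1
    rw [hp]
    simp only [← FreeGroup.mul_mk]
    group

def wl : List (Fin 3 × Bool) :=
  [(2,true),(2,true),(0,true),(0,true),(1,true),(1,true),(0,true),(0,true),(1,true),(1,true),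
    (2,true),(2,true)]

def wi : List (Fin 3 × Bool) :=
  [(2,false),(2,false),(1,false),(1,false),(0,false),(0,false),(1,false),(1,false),
    (0,false),(0,false),(2,false),(2,false)]

def Wd (x : Fin 2 × Bool) : List (Fin 3 × Bool) := if x.2 then wl else wi

def lf (x : Fin 2 × Bool) : List (Fin 3 × Bool) :=
  if x = (0, true) then [] else if x = (1, true) then [(0,true)]
  else if x = (0,false) then [(0,true)] else [(1,false)]

def rt (x : Fin 2 × Bool) : List (Fin 3 × Bool) :=
  if x = (0, true) then [(0,false)] else if x = (1, true) then [(1,true)]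
  else if x = (0,false) then [] else [(0,false)]

def mid (x y : Fin 2 × Bool) : List (Fin 3 × Bool) := FreeGroup.reduce (rt x ++ lf y)

noncomputable def S (i : Fin 2) : FreeGroup (Fin 3) := if i = 0 then w * a⁻¹ else a * w * b

lemma mk_wl : FreeGroup.mk wl = w := rfl

lemma mk_wi : FreeGroup.mk wi = w⁻¹ := by
  rw [← mk_wl, FreeGroup.inv_mk]; rfl

lemma val_eq (x : Fin 2 × Bool) : cond x.2 (S x.1) (S x.1)⁻¹ =
    FreeGroup.mk (lf x) * FreeGroup.mk (Wd x) * FreeGroup.mk (rt x) := by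
  have ha : FreeGroup.mk [((0 : Fin 3), true)] = a := rfl
  have ha' : FreeGroup.mk [((0 : Fin 3), false)] = a⁻¹ := rfl
  have hb : FreeGroup.mk [((1 : Fin 3), true)] = b := rfl
  have hb' : FreeGroup.mk [((1 : Fin 3), false)] = b⁻¹ := rfl
  have h1 : FreeGroup.mk ([] : List (Fin 3 × Bool)) = 1 := rfl
  obtain ⟨i, e⟩ := x
  fin_cases i <;> cases e <;>
    simp [S, lf, rt, Wd, ha, ha', hb, hb', h1, mk_wl, mk_wi, mul_assoc]

lemma mk_mid (x y : Fin 2 × Bool) :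
    FreeGroup.mk (mid x y) = FreeGroup.mk (rt x) * FreeGroup.mk (lf y) := by
  rw [mid, FreeGroup.reduce.self, FreeGroup.mul_mk]

lemma mid_red (x y : Fin 2 × Bool) (h : x.1 = y.1 → x.2 = y.2) :
    IsReduced (Wd x ++ mid x y ++ Wd y) := by
  unfold FreeGroup.IsReduced
  revert x y
  decide

def T : Fin 2 × Bool → List (Fin 2 × Bool) → Fin 2 × Bool → List (Fin 3 × Bool)
  | x, [], z => Wd x ++ mid x z
  | x, y :: L, z => Wd x ++ mid x y ++ T y L z

lemma T_head (x : Fin 2 × Bool) (L : List (Fin 2 × Bool)) (z : Fin 2 × Bool) :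
    ∃ R, T x L z = Wd x ++ R := by
  cases L with
  | nil => exact ⟨_, rfl⟩
  | cons y L => exact ⟨mid x y ++ T y L z, by simp [T]⟩

lemma T_val (x : Fin 2 × Bool) (L : List (Fin 2 × Bool)) (z : Fin 2 × Bool) :
    FreeGroup.mk (lf x) * FreeGroup.mk (T x L z) =
      FreeGroup.lift S (FreeGroup.mk (x :: L)) * FreeGroup.mk (lf z) := by
  induction L generalizing x with
  | nil =>
    rw [T, ← FreeGroup.mul_mk, mk_mid, FreeGroup.lift_mk]
    simp only [List.map_cons, List.map_nil, List.prod_cons, List.prod_nil, val_eq]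
    group
  | cons y L ih =>
    have e : FreeGroup.lift S (FreeGroup.mk (x :: y :: L)) =
        cond x.2 (S x.1) (S x.1)⁻¹ * FreeGroup.lift S (FreeGroup.mk (y :: L)) := by
      rw [FreeGroup.lift_mk, FreeGroup.lift_mk, List.map_cons, List.prod_cons]
    rw [e, mul_assoc, ← ih, T, ← FreeGroup.mul_mk, ← FreeGroup.mul_mk, mk_mid, val_eq]
    group

lemma Wd_ne (x : Fin 2 × Bool) : Wd x ≠ [] := by
  revert x; decide

lemma T_red (x : Fin 2 × Bool) (L : List (Fin 2 × Bool)) (z : Fin 2 × Bool)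
    (h : IsReduced (x :: L ++ [z])) : IsReduced (T x L z ++ Wd z) := by
  induction L generalizing x with
  | nil =>
    simp only [List.singleton_append, isReduced_cons_cons] at h
    exact mid_red x z h.1
  | cons y L ih =>
    simp only [List.cons_append, isReduced_cons_cons] at h
    have h2 := ih y h.2
    obtain ⟨R, hR⟩ := T_head y L z
    rw [hR, List.append_assoc] at h2
    have := (mid_red x y h.1).append_overlap h2 (Wd_ne y)
    rw [T, hR]
    simpa using this

lemma K_axis (g : FreeGroup (Fin 3)) (hg : g ∈ K) (h1 : g ≠ 1) :
    ∃ (h : FreeGroup (Fin 3)) (p y : List (Fin 3 × Bool)) (x : Fin 2 × Bool), p = Wd x ++ y ∧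
      IsReduced (p ++ p) ∧ h * FreeGroup.mk p * h⁻¹ = g := by
  have hK : K = (FreeGroup.lift S).range := by
    rw [FreeGroup.range_lift_eq_closure, K]
    congr 1
    ext t
    simp [S, Fin.exists_fin_two, eq_comm]
  rw [hK] at hg
  obtain ⟨z, rfl⟩ := hg
  have hz : z ≠ 1 := by rintro rfl; simp at h1
  have hc := FreeGroup.reduceCyclically.conj_conjugator_reduceCyclically z.toWord
  have hcr := FreeGroup.reduceCyclically.isCyclicallyReduced (isReduced_toWord (x := z))
  rcases hL : FreeGroup.reduceCyclically z.toWord with _ | ⟨x, L⟩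
  · rw [hL] at hc
    exfalso; apply hz
    rw [← FreeGroup.mk_toWord (x := z), ← hc, List.append_nil, ← FreeGroup.mul_mk,
      ← FreeGroup.inv_mk, mul_inv_cancel]
  · rw [hL] at hc hcr
    set k := FreeGroup.mk (FreeGroup.reduceCyclically.conjugator z.toWord) with hk
    have hzk : z = k * FreeGroup.mk (x :: L) * k⁻¹ := by
      rw [hk, FreeGroup.inv_mk, FreeGroup.mul_mk, FreeGroup.mul_mk, hc, FreeGroup.mk_toWord]
    have hred : IsReduced (x :: L ++ [x]) := by
      unfold FreeGroup.IsReduced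
      rw [List.isChain_append]
      refine ⟨hcr.1, List.isChain_singleton x, ?_⟩
      intro u hu v hv
      exact hcr.2 u hu v (by simpa using hv)
    have hT := T_red x L x hred
    obtain ⟨R, hR⟩ := T_head x L x
    refine ⟨FreeGroup.lift S k * FreeGroup.mk (lf x), T x L x, R, x, hR, ?_, ?_⟩
    · have := hT.append_overlap (L₃ := R) (red_sub hT ⟨[], Wd x, by rw [hR]; simp⟩) (Wd_ne x)
      nth_rw 2 [hR]
      simpa using this
    · have := T_val x L x
      rw [hzk, _root_.map_mul, _root_.map_mul, _root_.map_inv, mul_inv_rev,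
        mul_assoc (FreeGroup.lift S k), this]
      group

lemma K_turn (A : Subgroup (FreeGroup (Fin 3))) (g : FreeGroup (Fin 3)) (hg : g ∈ K) (h1 : g ≠ 1)
    (hgA : g ∈ A) (l1 l2 : List (Fin 3 × Bool)) (s t : Fin 3 × Bool)
    (hw : wl = l1 ++ [s] ++ (t :: l2)) : Turn A s (il t) := by
  obtain ⟨h, p, y, x, hp, hr, hh⟩ := K_axis g hg h1
  rw [← hh] at hgA
  by_cases hx : x.2 = true
  · rw [Wd, if_pos hx, hw] at hp
    exact turn_of_axis l1 l2 y s t p hp hr h hgA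
  · rw [Wd, if_neg hx] at hp
    have hwi : wi = FreeGroup.invRev l2 ++ [il t] ++ (il s :: FreeGroup.invRev l1) := by
      have : wi = FreeGroup.invRev wl := by decide
      rw [this, hw]; simp [FreeGroup.invRev, il]
    rw [hwi] at hp
    have := turn_of_axis _ _ y (il t) (il s) p hp hr h hgA
    have e : il (il s) = s := by simp [il]
    rw [e] at this
    exact turn_symm this

theorem K_inf_pfx (m : ℕ) (β : Fin (m+1) → FreeGroup (Fin 3)) (hb : IsFreeBasis β) :
    K ⊓ prefixSubgroup β m = ⊥ := by
  rw [eq_bot_iff]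
  rintro g ⟨hgK, hgA⟩
  rw [Subgroup.mem_bot]
  by_contra h1
  obtain ⟨χ, c1, c2, c3, c4⟩ := color_exists m β hb
  have tt := K_turn _ g hgK h1 hgA
  exact whitehead χ c1 _ c2 c3 c4
    (tt [] (wl.drop 2) (2,true) (2,true) rfl)
    (tt (wl.take 9) (wl.drop 11) (1,true) (2,true) rfl)
    (tt (wl.take 4) (wl.drop 6) (1,true) (1,true) rfl)
    (tt (wl.take 3) (wl.drop 5) (0,true) (1,true) rfl)
    (tt (wl.take 2) (wl.drop 4) (0,true) (0,true) rfl)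
    (tt (wl.take 1) (wl.drop 3) (2,true) (0,true) rfl)

def sg (x : Fin 3 × Bool) : List (Fin 3 × Bool) :=
  if x.1 = 2 then (if x.2 then wl else wi) else [x]

noncomputable def B3 (i : Fin 3) : FreeGroup (Fin 3) := if i = 0 then a else if i = 1 then b else w

lemma sg_val (x : Fin 3 × Bool) : cond x.2 (B3 x.1) (B3 x.1)⁻¹ = FreeGroup.mk (sg x) := by
  obtain ⟨i, e⟩ := x
  fin_cases i <;> cases e <;> simp [B3, sg, mk_wl, mk_wi] <;> rfl

lemma lift_B3_mk (L : List (Fin 3 × Bool)) :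
    FreeGroup.lift B3 (FreeGroup.mk L) = FreeGroup.mk (L.map sg).flatten := by
  rw [FreeGroup.lift_mk]
  induction L with
  | nil => rfl
  | cons x L ih => rw [List.map_cons, List.prod_cons, ih, sg_val, FreeGroup.mul_mk]; rfl

lemma sg_ne (x : Fin 3 × Bool) : sg x ≠ [] := by revert x; decide

lemma sg_red (x : Fin 3 × Bool) : IsReduced (sg x) := by
  unfold FreeGroup.IsReduced; revert x; decide

lemma sg_pair (x y : Fin 3 × Bool) (h : x.1 = y.1 → x.2 = y.2) :
    ∀ u ∈ (sg x).getLast?, ∀ v ∈ (sg y).head?, u.1 = v.1 → u.2 = v.2 := by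
  revert x y; decide

lemma flat_red (L : List (Fin 3 × Bool)) (h : IsReduced L) : IsReduced (L.map sg).flatten := by
  unfold FreeGroup.IsReduced
  rw [List.isChain_flatten]
  · refine ⟨?_, ?_⟩
    · intro l hl
      obtain ⟨x, _, rfl⟩ := List.mem_map.1 hl
      exact sg_red x
    · rw [List.isChain_map]
      exact List.IsChain.imp (fun x y hxy => sg_pair x y hxy) h
  · intro h
    obtain ⟨x, _, hx⟩ := List.mem_map.1 h
    exact sg_ne x hx

lemma inj_B3 : Function.Injective (FreeGroup.lift B3) := by
  rw [injective_iff_map_eq_one]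
  intro z hz
  rw [← FreeGroup.mk_toWord (x := z), lift_B3_mk] at hz
  have h1 := congrArg FreeGroup.norm hz
  rw [norm_mk_of_red (flat_red _ isReduced_toWord), FreeGroup.norm_one] at h1
  have h2 := List.length_eq_zero_iff.1 h1
  rw [← FreeGroup.toWord_eq_nil_iff]
  rcases h3 : z.toWord with _ | ⟨x, L⟩
  · rfl
  · rw [h3] at h2
    simp [sg_ne] at h2

lemma range_B3 : (FreeGroup.lift B3).range = H := by
  rw [FreeGroup.range_lift_eq_closure, H]
  congr 1
  ext t
  simp [B3, Fin.exists_fin_succ, eq_comm]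

lemma hasRank_of {G : Type} [Group G] {n : ℕ} (f : FreeGroup (Fin n) →* G)
    (hf : Function.Injective f) (L : Subgroup G) (hL : f.range = L) : HasRank L n := by
  subst hL
  exact ⟨MonoidHom.ofInjective hf⟩

lemma hasRank_pfx {G : Type} [Group G] {n : ℕ} (β : Fin n → G) (hb : IsFreeBasis β) (i : ℕ)
    (hi : i ≤ n) : HasRank (prefixSubgroup β i) i := by
  refine hasRank_of ((FreeGroup.lift β).comp (FreeGroup.map (Fin.castLE hi)))
    (hb.1.comp (FreeGroup.map_injective (Fin.castLE_injective hi))) _ ?_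
  rw [MonoidHom.range_comp, FreeGroup.range_map, MonoidHom.map_closure, prefixSubgroup]
  congr 1
  ext t
  simp only [Set.mem_image, Set.mem_range, Set.mem_ofPred_eq]
  constructor
  · rintro ⟨_, ⟨_, ⟨j, rfl⟩, rfl⟩, rfl⟩
    exact ⟨Fin.castLE hi j, j.2, by simp⟩
  · rintro ⟨j, hj, rfl⟩
    exact ⟨FreeGroup.of j, ⟨j, ⟨⟨j, hj⟩, rfl⟩, rfl⟩, by simp⟩

lemma pfx_mono {G : Type} [Group G] {n : ℕ} (β : Fin n → G) {i j : ℕ} (h : i ≤ j) :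
    prefixSubgroup β i ≤ prefixSubgroup β j := by
  apply Subgroup.closure_mono
  apply Set.image_mono
  intro k hk
  exact lt_of_lt_of_le hk h

lemma pfx_top {G : Type} [Group G] {n : ℕ} (β : Fin n → G) (hb : IsFreeBasis β) :
    prefixSubgroup β n = ⊤ := by
  have := FreeGroup.lift_surjective_iff_closure_range_eq_top.1 hb.2
  rw [← this, prefixSubgroup]
  congr 1
  ext t
  simp

lemma echelon_pfx {G : Type} [Group G] {n : ℕ} (β : Fin n → G) (hb : IsFreeBasis β) (k : ℕ)
    (hk : k ≤ n) : IsEchelon (prefixSubgroup β k) := by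
  have key : ∀ i, i ≤ n → HasRank (prefixSubgroup β k ⊓ prefixSubgroup β i) (min k i) := by
    intro i hi
    rcases le_total k i with h | h
    · rw [inf_eq_left.2 (pfx_mono β h), min_eq_left h]; exact hasRank_pfx β hb k hk
    · rw [inf_eq_right.2 (pfx_mono β h), min_eq_right h]; exact hasRank_pfx β hb i hi
  refine ⟨n, β, hb, fun i => ⟨_, _, key i (by omega), key (i+1) (by omega), by omega⟩⟩

lemma freeFactor_pfx {G : Type} [Group G] {n : ℕ} (β : Fin n → G) (hb : IsFreeBasis β) (k : ℕ) :
    IsFreeFactor (prefixSubgroup β k) := by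
  set A := prefixSubgroup β k with hA
  set B : Subgroup G := Subgroup.closure (β '' {j | ¬ (j : ℕ) < k}) with hB
  have hAm : ∀ j : Fin n, (j : ℕ) < k → β j ∈ A := fun j hj =>
    Subgroup.subset_closure ⟨j, hj, rfl⟩
  have hBm : ∀ j : Fin n, ¬ (j : ℕ) < k → β j ∈ B := fun j hj =>
    Subgroup.subset_closure ⟨j, hj, rfl⟩
  refine ⟨B, ?_, ?_⟩
  · let e : FreeGroup (Fin n) ≃* G := MulEquiv.ofBijective (FreeGroup.lift β) hb
    have he : ∀ i, e.symm (β i) = FreeGroup.of i := by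
      intro i
      rw [MulEquiv.symm_apply_eq]
      exact (FreeGroup.lift_apply_of (f := β)).symm
    let ψ0 : FreeGroup (Fin n) →* Monoid.Coprod A B := FreeGroup.lift fun j =>
      if hj : (j : ℕ) < k then Monoid.Coprod.inl ⟨β j, hAm j hj⟩
      else Monoid.Coprod.inr ⟨β j, hBm j hj⟩
    let ψ : G →* Monoid.Coprod A B := ψ0.comp e.symm.toMonoidHom
    have hψA : ∀ x (hx : x ∈ A), ψ x = Monoid.Coprod.inl ⟨x, hx⟩ := by
      intro x hx
      induction hx using Subgroup.closure_induction with
      | mem x hx =>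
        obtain ⟨j, hj, rfl⟩ := hx
        have hj' : (j : ℕ) < k := hj
        simp [ψ, he, ψ0, hj']
      | one => rw [_root_.map_one]; exact (_root_.map_one _).symm
      | mul x y hx hy h1 h2 => rw [_root_.map_mul, h1, h2, ← _root_.map_mul]; rfl
      | inv x hx h1 => rw [_root_.map_inv, h1, ← _root_.map_inv]; rfl
    have hψB : ∀ x (hx : x ∈ B), ψ x = Monoid.Coprod.inr ⟨x, hx⟩ := by
      intro x hx
      induction hx using Subgroup.closure_induction with
      | mem x hx =>
        obtain ⟨j, hj, rfl⟩ := hx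
        have hj' : ¬ (j : ℕ) < k := hj
        simp only [ψ, ψ0, MonoidHom.comp_apply, MulEquiv.coe_toMonoidHom, he,
          FreeGroup.lift_apply_of, dif_neg hj']
      | one => rw [_root_.map_one]; exact (_root_.map_one _).symm
      | mul x y hx hy h1 h2 => rw [_root_.map_mul, h1, h2, ← _root_.map_mul]; rfl
      | inv x hx h1 => rw [_root_.map_inv, h1, ← _root_.map_inv]; rfl
    have hid : ψ.comp (Monoid.Coprod.lift A.subtype B.subtype) = MonoidHom.id _ := by
      apply Monoid.Coprod.hom_ext
      · ext x
        exact hψA x x.2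
      · ext x
        exact hψB x x.2
    exact Function.LeftInverse.injective (g := ψ) fun x => DFunLike.congr_fun hid x
  · rw [← MonoidHom.range_eq_top, Monoid.Coprod.range_lift, Subgroup.range_subtype,
      Subgroup.range_subtype, hA, hB, prefixSubgroup, ← Subgroup.closure_union,
      ← Set.image_union]
    rw [← FreeGroup.lift_surjective_iff_closure_range_eq_top.1 hb.2]
    congr 1
    ext t
    simp only [Set.mem_image, Set.mem_union, Set.mem_ofPred_eq, Set.mem_range]
    constructor
    · rintro ⟨j, _, rfl⟩; exact ⟨j, rfl⟩
    · rintro ⟨j, rfl⟩; exact ⟨j, em _, rfl⟩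

noncomputable def eH : FreeGroup (Fin 3) ≃* H :=
  (MonoidHom.ofInjective inj_B3).trans (MulEquiv.subgroupCongr range_B3)

lemma eH_of (i : Fin 3) : ((eH (FreeGroup.of i) : H) : FreeGroup (Fin 3)) = B3 i := by
  exact FreeGroup.lift_apply_of (f := B3)

def t1 (i : Fin 3) : FreeGroup (Fin 3) :=
  if i = 0 then FreeGroup.of 2 * (FreeGroup.of 0)⁻¹
  else if i = 1 then FreeGroup.of 0 * FreeGroup.of 2 * FreeGroup.of 1 else FreeGroup.of 0

def t2 (i : Fin 3) : FreeGroup (Fin 3) :=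
  if i = 0 then FreeGroup.of 2
  else if i = 1 then (FreeGroup.of 2 * FreeGroup.of 0 * FreeGroup.of 2)⁻¹ * FreeGroup.of 1
  else FreeGroup.of 0 * FreeGroup.of 2

noncomputable def tau : FreeGroup (Fin 3) ≃* FreeGroup (Fin 3) :=
  MonoidHom.toMulEquiv (FreeGroup.lift t1) (FreeGroup.lift t2)
    (by ext i; fin_cases i <;> simp [t1, t2, mul_assoc])
    (by ext i; fin_cases i <;> simp [t1, t2, mul_assoc])

noncomputable def bH (i : Fin 3) : H := eH (tau (FreeGroup.of i))

lemma bH_basis : IsFreeBasis bH := by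
  have : FreeGroup.lift bH = (tau.trans eH).toMonoidHom := by
    ext i; simp [bH]
  rw [IsFreeBasis, this]
  exact (tau.trans eH).bijective

lemma bH_zero : ((bH 0 : H) : FreeGroup (Fin 3)) = w * a⁻¹ := by
  have : tau (FreeGroup.of 0) = t1 0 := by
    rw [tau, MonoidHom.toMulEquiv_apply, FreeGroup.lift_apply_of]
  rw [bH, this]
  simp [t1, eH_of, B3]

lemma bH_one : ((bH 1 : H) : FreeGroup (Fin 3)) = a * w * b := by
  have : tau (FreeGroup.of 1) = t1 1 := by
    rw [tau, MonoidHom.toMulEquiv_apply, FreeGroup.lift_apply_of]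
  rw [bH, this]
  simp [t1, eH_of, B3]

lemma K_le_H : K ≤ H := by
  rw [K, Subgroup.closure_le]
  rintro x (rfl | rfl)
  · rw [← bH_zero]; exact (bH 0).2
  · rw [← bH_one]; exact (bH 1).2

lemma K_eq_pfx : K.subgroupOf H = prefixSubgroup bH 2 := by
  apply Subgroup.map_injective H.subtype_injective
  rw [Subgroup.subgroupOf_map_subtype, inf_eq_left.2 K_le_H, prefixSubgroup,
    MonoidHom.map_closure, K]
  congr 1
  have : {j : Fin 3 | (j : ℕ) < 2} = {0, 1} := by
    ext j; fin_cases j <;> simp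
  rw [this, Set.image_pair, Set.image_pair]
  simp [bH_zero, bH_one]

lemma K_rank : HasRank K 2 := by
  have := hasRank_pfx bH bH_basis 2 (by norm_num)
  rw [← K_eq_pfx] at this
  obtain ⟨e⟩ := this
  exact ⟨e.trans (Subgroup.subgroupOfEquivOfLe K_le_H)⟩

lemma rank_unique {G : Type} [Group G] {L : Subgroup G} {r s : ℕ} (h1 : HasRank L r)
    (h2 : HasRank L s) : r = s := by
  obtain ⟨e1⟩ := h1
  obtain ⟨e2⟩ := h2
  have := Fintype.card_congr (Equiv.ofFreeGroupEquiv (e1.trans e2.symm))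
  simpa using this

lemma of_basis : IsFreeBasis (FreeGroup.of : Fin 3 → FreeGroup (Fin 3)) := by
  rw [IsFreeBasis, FreeGroup.lift_of_eq_id]
  exact Function.bijective_id

lemma H_echelon : IsEchelon H := by
  have key : ∀ i, i ≤ 3 →
      HasRank (H ⊓ prefixSubgroup (FreeGroup.of : Fin 3 → FreeGroup (Fin 3)) i) i := by
    intro i hi
    rcases Nat.lt_or_ge i 3 with h | h
    · rw [inf_eq_right.2]
      · exact hasRank_pfx _ of_basis i hi
      · rw [prefixSubgroup, Subgroup.closure_le]
        rintro _ ⟨j, hj, rfl⟩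
        have hj' : (j : ℕ) < i := hj
        apply Subgroup.subset_closure
        fin_cases j
        · left; rfl
        · right; left; rfl
        · simp at hj'; omega
    · have : i = 3 := by omega
      subst this
      rw [pfx_top _ of_basis, inf_top_eq]
      exact hasRank_of _ inj_B3 _ range_B3
  exact ⟨3, _, of_basis, fun i => ⟨_, _, key i (by omega), key (i+1) (by omega), le_rfl⟩⟩

lemma K_not_echelon : ¬ IsEchelon K := by
  rintro ⟨m, β, hb, hβ⟩
  have hm := Fintype.card_congr (Equiv.ofFreeGroupEquiv (MulEquiv.ofBijective _ hb))
  simp only [Fintype.card_fin] at hm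
  subst hm
  obtain ⟨r, r', h1, h2, h3⟩ := hβ 2
  have e2 : HasRank K r := by
    have : ((2 : Fin 3) : ℕ) + 1 = 3 := rfl
    rwa [this, pfx_top β hb, inf_top_eq] at h2
  have e1 : HasRank (⊥ : Subgroup (FreeGroup (Fin 3))) r' := by
    have h := K_inf_pfx 2 β hb
    have : ((2 : Fin 3) : ℕ) = 2 := rfl
    rwa [this, h] at h1
  have e3 : HasRank (⊥ : Subgroup (FreeGroup (Fin 3))) 0 := by
    have := hasRank_pfx _ of_basis 0 (by norm_num)
    simpa [prefixSubgroup] using this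
  have := rank_unique e2 K_rank
  have := rank_unique e1 e3
  omega

end Ech

theorem statement16 :
    IsFreeFactorIn K H ∧ IsEchelon (K.subgroupOf H) ∧ IsEchelon H ∧ ¬ IsEchelon K := by
  refine ⟨⟨Ech.K_le_H, ?_⟩, ?_, Ech.H_echelon, Ech.K_not_echelon⟩
  · rw [Ech.K_eq_pfx]; exact Ech.freeFactor_pfx _ Ech.bH_basis 2
  · rw [Ech.K_eq_pfx]; exact Ech.echelon_pfx _ Ech.bH_basis 2 (by norm_num)
end
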